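/- arXiv:math/0311535 — 3 statements merged into one kernel-verified Lean document; each statement's English description precedes it below -/
import Mathlib

section
/- With M as above and L the adjacency matrix of the line graph of K_9 (rows/columns indexed by 2-subsets of {1,…,9}, adjacency being nonempty intersection), one has MᵀM = 50·I + 20·J − 10·L, where J is the all-ones 36×36 matrix. -/
open scoped Classical

/-- A partition of `{1,…,9}` (modelled as `Fin 9`) into three cells of size three. -/
def IsPartition33 (P : Finset (Finset (Fin 9))) : Prop :=
  P.card = 3 ∧ (∀ c ∈ P, c.card = 3) ∧ P.sup id = Finset.univ

/-- Row index type: the 280 partitions of type `3³`. -/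
abbrev Part33 := {P : Finset (Finset (Fin 9)) // IsPartition33 P}

/-- Column index type: the 36 two-element subsets of `{1,…,9}`. -/
abbrev Pair9 := {e : Finset (Fin 9) // e.card = 2}

/-- The 280 × 36 incidence matrix `M`: entry 1 iff the 2-subset is contained
in a cell of the partition. -/
noncomputable def M : Matrix Part33 Pair9 ℝ :=
  Matrix.of fun P e => if ∃ c ∈ P.1, e.1 ⊆ c then 1 else 0

/-- Adjacency matrix of the line graph of `K₉`: two 2-subsets are adjacent iff
they are distinct and intersect. -/
noncomputable def L : Matrix Pair9 Pair9 ℝ :=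
  Matrix.of fun e f => if e ≠ f ∧ (e.1 ∩ f.1).Nonempty then 1 else 0

open Finset

theorem isPartition33_iff (P : Finset (Finset (Fin 9))) :
    IsPartition33 P ↔ P.card = 3 ∧ (∀ c ∈ P, c.card = 3) ∧ ∀ x, ∃ c ∈ P, x ∈ c := by
  simp [IsPartition33, Finset.ext_iff, Finset.mem_sup]

/-- The partitions of type `3³` in which both `e` and `f` are contained in a cell. -/
noncomputable def commonPartitions (e f : Finset (Fin 9)) : Finset (Finset (Finset (Fin 9))) :=
  univ.filter fun P => IsPartition33 P ∧ (∃ c ∈ P, e ⊆ c) ∧ ∃ c ∈ P, f ⊆ c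

theorem card_commonPartitions_map (σ : Equiv.Perm (Fin 9)) (e f : Finset (Fin 9)) :
    (commonPartitions (e.map σ.toEmbedding) (f.map σ.toEmbedding)).card =
      (commonPartitions e f).card := by
  symm
  refine Finset.card_equiv σ.finsetCongr.finsetCongr fun P => ?_
  have hcover : (∀ x, ∃ c ∈ P, x ∈ c) ↔ ∀ x, ∃ c ∈ P, σ.symm x ∈ c :=
    σ.symm.forall_congr_right.symm
  simp only [commonPartitions, isPartition33_iff, mem_filter, mem_univ, true_and, hcover,
    Equiv.finsetCongr_apply, card_map, mem_map, Equiv.coe_toEmbedding, forall_exists_index,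
    and_imp, forall_apply_eq_imp_iff₂, exists_exists_and_eq_and, map_subset_map,
    ← Equiv.eq_symm_apply, exists_eq_right]

/-- The set of cells consisting of two given cells and the complement of their union. -/
def cellsOfPair (x : Finset (Fin 9) × Finset (Fin 9)) : Finset (Finset (Fin 9)) :=
  {x.1, x.2, (x.1 ∪ x.2)ᶜ}

/-- The pairs of disjoint 3-subsets, the first one containing `e`, such that `f` is contained in
a cell of the partition they generate. -/
def cellPairs (e f : Finset (Fin 9)) : Finset (Finset (Fin 9) × Finset (Fin 9)) :=
  ((powersetCard 3 univ).filter (e ⊆ ·) ×ˢ powersetCard 3 univ).filter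
    fun x => Disjoint x.1 x.2 ∧ ∃ c ∈ cellsOfPair x, f ⊆ c

theorem isPartition33_cellsOfPair {c d : Finset (Fin 9)} (hc : c.card = 3) (hd : d.card = 3)
    (hcd : Disjoint c d) : IsPartition33 (cellsOfPair (c, d)) := by
  have hr : ((c ∪ d)ᶜ).card = 3 := by
    rw [card_compl, card_union_of_disjoint hcd, hc, hd, Fintype.card_fin]
  have hne : c.Nonempty := card_pos.1 (by omega)
  have hnd : d.Nonempty := card_pos.1 (by omega)
  have h₁ : c ≠ d := by
    rintro rfl
    exact hne.ne_empty (disjoint_self.1 hcd)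
  have h₂ : c ≠ (c ∪ d)ᶜ := by
    intro h
    obtain ⟨x, hx⟩ := hne
    exact mem_compl.1 (h ▸ hx) (mem_union_left _ hx)
  have h₃ : d ≠ (c ∪ d)ᶜ := by
    intro h
    obtain ⟨x, hx⟩ := hnd
    exact mem_compl.1 (h ▸ hx) (mem_union_right _ hx)
  rw [isPartition33_iff]
  refine ⟨card_eq_three.2 ⟨_, _, _, h₁, h₂, h₃, rfl⟩, ?_, fun x => ?_⟩
  · simp [cellsOfPair, hc, hd, hr, -compl_union]
  · simp only [cellsOfPair, mem_insert, mem_singleton, exists_eq_or_imp, exists_eq_left,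
      mem_compl, mem_union]
    tauto

theorem IsPartition33.exists_eq_cellsOfPair {P : Finset (Finset (Fin 9))} (hP : IsPartition33 P)
    {c : Finset (Fin 9)} (hc : c ∈ P) :
    ∃ d, d.card = 3 ∧ Disjoint c d ∧ P = cellsOfPair (c, d) := by
  obtain ⟨hcard, hcells, hcover⟩ := (isPartition33_iff P).1 hP
  obtain ⟨d, r, hdr, hPc⟩ := card_eq_two.1 (by rw [card_erase_of_mem hc, hcard] :
    (P.erase c).card = 2)
  have hPeq : P = {c, d, r} := by rw [← insert_erase hc, hPc]
  subst hPeq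
  simp only [mem_insert, mem_singleton, forall_eq_or_imp, forall_eq, exists_eq_or_imp,
    exists_eq_left] at hcells hcover
  obtain ⟨hc3, hd3, hr3⟩ := hcells
  have hsub : (c ∪ d)ᶜ ⊆ r := fun x hx => by
    have := hcover x
    simp only [mem_compl, mem_union] at hx
    tauto
  have hle := card_le_card hsub
  have hunion := card_union_add_card_inter c d
  rw [card_compl, Fintype.card_fin] at hle
  refine ⟨d, hd3, ?_, ?_⟩
  · rw [disjoint_iff_inter_eq_empty, ← card_eq_zero]
    omega
  · rw [cellsOfPair, eq_of_subset_of_card_le hsub]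
    rw [card_compl, Fintype.card_fin]
    omega

theorem commonPartitions_eq_image (e f : Finset (Fin 9)) :
    commonPartitions e f = (cellPairs e f).image cellsOfPair := by
  ext P
  simp only [commonPartitions, cellPairs, mem_filter, mem_univ, true_and, mem_image, mem_product,
    mem_powersetCard, subset_univ, Prod.exists]
  constructor
  · rintro ⟨hP, ⟨c, hc, hec⟩, hf⟩
    obtain ⟨d, hd, hcd, rfl⟩ := hP.exists_eq_cellsOfPair hc
    exact ⟨c, d, ⟨⟨⟨((isPartition33_iff _).1 hP).2.1 c hc, hec⟩, hd⟩, hcd, hf⟩, rfl⟩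
  · rintro ⟨c, d, ⟨⟨⟨hc, hec⟩, hd⟩, hcd, hf⟩, rfl⟩
    exact ⟨isPartition33_cellsOfPair hc hd hcd, ⟨c, by simp [cellsOfPair], hec⟩, hf⟩

theorem exists_perm_apply_eq {n : ℕ} {v w : Fin n → Fin 9} (hv : v.Injective)
    (hw : w.Injective) : ∃ σ : Equiv.Perm (Fin 9), ∀ i, σ (v i) = w i := by
  have := Equiv.Perm.isMultiplyPretransitive (Fin 9) n
  obtain ⟨σ, hσ⟩ := MulAction.exists_smul_eq (Equiv.Perm (Fin 9))
    (⟨v, hv⟩ : Fin n ↪ Fin 9) ⟨w, hw⟩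
  exact ⟨σ, fun i => DFunLike.congr_fun hσ i⟩

theorem card_commonPartitions_self {a b : Fin 9} (hab : a ≠ b) :
    (commonPartitions {a, b} {a, b}).card = 70 := by
  obtain ⟨σ, hσ⟩ := exists_perm_apply_eq (v := ![0, 1]) (w := ![a, b]) (by decide)
    (by simp [Function.Injective, Fin.forall_fin_succ, hab, hab.symm])
  simp only [Fin.forall_fin_succ] at hσ
  have h := card_commonPartitions_map σ {0, 1} {0, 1}
  simp_all only [map_insert, map_singleton, Equiv.coe_toEmbedding, Matrix.cons_val_zero,
    Matrix.cons_val_succ]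
  rw [commonPartitions_eq_image]
  decide +kernel

theorem card_commonPartitions_adjacent {a b c : Fin 9} (hab : a ≠ b) (hac : a ≠ c)
    (hbc : b ≠ c) : (commonPartitions {a, b} {a, c}).card = 10 := by
  obtain ⟨σ, hσ⟩ := exists_perm_apply_eq (v := ![0, 1, 2]) (w := ![a, b, c]) (by decide)
    (by simp [Function.Injective, Fin.forall_fin_succ, *, hab.symm, hac.symm, hbc.symm])
  simp only [Fin.forall_fin_succ] at hσ
  have h := card_commonPartitions_map σ {0, 1} {0, 2}
  simp_all only [map_insert, map_singleton, Equiv.coe_toEmbedding, Matrix.cons_val_zero,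
    Matrix.cons_val_succ]
  rw [commonPartitions_eq_image]
  decide +kernel

theorem card_commonPartitions_disjoint {a b c d : Fin 9} (hab : a ≠ b) (hac : a ≠ c)
    (had : a ≠ d) (hbc : b ≠ c) (hbd : b ≠ d) (hcd : c ≠ d) :
    (commonPartitions {a, b} {c, d}).card = 20 := by
  obtain ⟨σ, hσ⟩ := exists_perm_apply_eq (v := ![0, 1, 2, 3]) (w := ![a, b, c, d]) (by decide)
    (by simp [Function.Injective, Fin.forall_fin_succ, *, hab.symm, hac.symm, had.symm,
      hbc.symm, hbd.symm, hcd.symm])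
  simp only [Fin.forall_fin_succ] at hσ
  have h := card_commonPartitions_map σ {0, 1} {2, 3}
  simp_all only [map_insert, map_singleton, Equiv.coe_toEmbedding, Matrix.cons_val_zero,
    Matrix.cons_val_succ]
  rw [commonPartitions_eq_image]
  decide +kernel

theorem MT_mul_M_apply (e f : Pair9) :
    (M.transpose * M) e f = ((commonPartitions e.1 f.1).card : ℝ) := by
  have hS : commonPartitions e.1 f.1 =
      (univ.filter fun P : Part33 => (∃ c ∈ P.1, e.1 ⊆ c) ∧ ∃ c ∈ P.1, f.1 ⊆ c).map
        (Function.Embedding.subtype _) := by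
    ext P
    simp [commonPartitions, and_comm (a := IsPartition33 P)]
  rw [hS, card_map, Matrix.mul_apply, card_filter]
  push_cast
  refine sum_congr rfl fun P _ => ?_
  simp only [M, Matrix.transpose_apply, Matrix.of_apply, ite_and, ite_mul, one_mul, zero_mul]

theorem MT_mul_M :
    M.transpose * M = (50 : ℝ) • (1 : Matrix Pair9 Pair9 ℝ)
      + (20 : ℝ) • (Matrix.of fun _ _ => (1 : ℝ)) - (10 : ℝ) • L := by
  ext e f
  rw [MT_mul_M_apply]
  simp only [Matrix.sub_apply, Matrix.add_apply, Matrix.smul_apply, Matrix.of_apply, L,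
    smul_eq_mul, Matrix.one_apply]
  by_cases hef : e = f
  · subst hef
    obtain ⟨a, b, hab, he⟩ := card_eq_two.1 e.2
    rw [he, card_commonPartitions_self hab]
    norm_num
  by_cases hmeet : (e.1 ∩ f.1).Nonempty
  · obtain ⟨a, ha⟩ := hmeet
    obtain ⟨hae, haf⟩ := mem_inter.1 ha
    obtain ⟨b, hb⟩ := card_eq_one.1 (by rw [card_erase_of_mem hae, e.2] : (e.1.erase a).card = 1)
    obtain ⟨c, hc⟩ := card_eq_one.1 (by rw [card_erase_of_mem haf, f.2] : (f.1.erase a).card = 1)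
    have he : e.1 = {a, b} := by rw [← insert_erase hae, hb]
    have hf : f.1 = {a, c} := by rw [← insert_erase haf, hc]
    have hba : b ≠ a := (mem_erase.1 (hb ▸ mem_singleton_self b)).1
    have hca : c ≠ a := (mem_erase.1 (hc ▸ mem_singleton_self c)).1
    have hbc : b ≠ c := by
      rintro rfl
      exact hef (Subtype.ext (he.trans hf.symm))
    rw [if_neg hef, if_pos ⟨hef, a, ha⟩, he, hf,
      card_commonPartitions_adjacent hba.symm hca.symm hbc]
    norm_num
  · obtain ⟨a, b, hab, he⟩ := card_eq_two.1 e.2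
    obtain ⟨c, d, hcd, hf⟩ := card_eq_two.1 f.2
    rw [if_neg hef, if_neg fun h => hmeet h.2]
    rw [not_nonempty_iff_eq_empty, ← disjoint_iff_inter_eq_empty, he, hf] at hmeet
    simp only [disjoint_insert_left, disjoint_singleton_left, mem_insert, mem_singleton,
      not_or] at hmeet
    obtain ⟨⟨hac, had⟩, hbc, hbd⟩ := hmeet
    rw [he, hf, card_commonPartitions_disjoint hab hac had hbc hbd hcd]
    norm_num
end

section
/- Let v ≥ 2k. The maximum size of an independent set in the q-Kneser graph qK_{v:k} (k-subspaces of GF(q)^v, adjacent when they intersect trivially) is the Gaussian binomial coefficient [v−1 choose k−1]_q, attained by the set of k-subspaces containing a fixed 1-dimensional subspace. -/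
open scoped Classical

/-- The Gaussian (q-)binomial coefficient `[n choose r]_q`. -/
def gaussBinomial (q n r : ℕ) : ℕ :=
  ((Finset.range r).prod fun i => q ^ (n - i) - 1) /
    ((Finset.range r).prod fun i => q ^ (i + 1) - 1)

/-- The vertices of the q-Kneser graph: `k`-dimensional subspaces of `GF(q)^v`. -/
abbrev qKneserVert (F : Type*) [Field F] (v k : ℕ) :=
  {U : Submodule F (Fin v → F) // Module.finrank F U = k}

/-- A set of `k`-subspaces is independent in the q-Kneser graph iff its members
pairwise intersect non-trivially. -/
def qKneserIndep {F : Type*} [Field F] {v k : ℕ} (S : Set (qKneserVert F v k)) : Prop :=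
  ∀ U ∈ S, ∀ W ∈ S, U ≠ W → U.1 ⊓ W.1 ≠ ⊥

section
open Finset Module

lemma sup_inf_eq_left_of_inf_eq_bot {F V : Type*} [Field F] [AddCommGroup V] [Module F V]
    {U J K : Submodule F V} (hJK : J ≤ K) (hKU : K ⊓ U = ⊥) :
    (J ⊔ U) ⊓ K = J := by
  rw [sup_inf_assoc_of_le U hJK, inf_comm U K, hKU, sup_bot_eq]

variable {F V : Type*} [Field F] [Fintype F] [AddCommGroup V] [Module F V] [Fintype V]

lemma card_sdiff_submodule {J K : Submodule F V} (hJK : J ≤ K) :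
    ((#{x : V | x ∈ K ∧ x ∉ J} : ℕ) : ℝ) =
      (Fintype.card F : ℝ) ^ finrank F K - (Fintype.card F : ℝ) ^ finrank F J := by
  have h (W : Submodule F V) : #{x : V | x ∈ W} = Fintype.card F ^ finrank F W := by
    rw [← Module.card_eq_pow_finrank (K := F) (V := W), Fintype.card_subtype]
  have hs : ({x : V | x ∈ K ∧ x ∉ J} : Finset V) =
      ({x | x ∈ K} : Finset V) \ ({x | x ∈ J} : Finset V) := by
    ext; simp
  rw [hs, cast_card_sdiff (fun x hx => by simp at hx ⊢; exact hJK hx), h, h]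
  push_cast; rfl

variable [Fintype (Submodule F V)]

/-- The `k`-dimensional subspaces `K` with `J ≤ K ≤ M` that meet `U` trivially. -/
noncomputable def subspacesAvoiding (k : ℕ) (M U J : Submodule F V) : Finset (Submodule F V) :=
  ({K | J ≤ K ∧ K ≤ M ∧ K ⊓ U = ⊥ ∧ finrank F K = k} : Finset (Submodule F V))

lemma card_subspacesAvoiding_succ {k : ℕ} {M U J : Submodule F V} {c : ℝ}
    (hU : U ≤ M) (hJ : J ≤ M) (hJU : J ⊓ U = ⊥)
    (hc : ∀ J' ≤ M, J' ⊓ U = ⊥ → finrank F J' = finrank F J + 1 →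
      (#(subspacesAvoiding k M U J') : ℝ) = c) :
    (#(subspacesAvoiding k M U J) : ℝ) *
        ((Fintype.card F : ℝ) ^ k - (Fintype.card F : ℝ) ^ finrank F J) =
      ((Fintype.card F : ℝ) ^ finrank F M -
        (Fintype.card F : ℝ) ^ (finrank F U + finrank F J)) * c := by
  have hsup : finrank F ↥(J ⊔ U) = finrank F U + finrank F J := by
    have := Submodule.finrank_sup_add_finrank_inf_eq J U
    rw [hJU, finrank_bot] at this
    omega
  have hdc := sum_card_bipartiteAbove_eq_sum_card_bipartiteBelow
    (s := subspacesAvoiding k M U J) (t := ({x | x ∈ M ∧ x ∉ J ⊔ U} : Finset V))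
    (fun K x => x ∈ K)
  have h1 : ∀ K ∈ subspacesAvoiding k M U J,
      ((#(bipartiteAbove (fun K x => x ∈ K) ({x | x ∈ M ∧ x ∉ J ⊔ U} : Finset V) K) : ℕ) : ℝ) =
        (Fintype.card F : ℝ) ^ k - (Fintype.card F : ℝ) ^ finrank F J := by
    intro K hK
    simp only [subspacesAvoiding, mem_filter, mem_univ, true_and] at hK
    obtain ⟨hJK, hKM, hKU, rfl⟩ := hK
    rw [← card_sdiff_submodule hJK]
    congr 2
    ext x
    have := sup_inf_eq_left_of_inf_eq_bot hJK hKU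
    have hx : x ∈ (J ⊔ U) ⊓ K ↔ x ∈ J := by rw [this]
    rw [Submodule.mem_inf] at hx
    simp only [bipartiteAbove, mem_filter, mem_univ, true_and]
    exact ⟨fun ⟨⟨_, h⟩, hK⟩ => ⟨hK, fun hJ => h (hx.2 hJ).1⟩,
      fun ⟨hK, h⟩ => ⟨⟨hKM hK, fun h' => h (hx.1 ⟨h', hK⟩)⟩, hK⟩⟩
  have h2 : ∀ x ∈ ({x | x ∈ M ∧ x ∉ J ⊔ U} : Finset V),
      ((#(bipartiteBelow (fun K x => x ∈ K) (subspacesAvoiding k M U J) x) : ℕ) : ℝ) = c := by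
    intro x hx
    simp only [mem_filter, mem_univ, true_and] at hx
    obtain ⟨hxM, hx⟩ := hx
    have hx0 : x ≠ 0 := fun h => hx (h ▸ Submodule.zero_mem _)
    have hd : Disjoint (F ∙ x) (J ⊔ U) := by
      rw [disjoint_comm, Submodule.disjoint_span_singleton' hx0]; exact hx
    rw [← hc (J ⊔ F ∙ x)]
    · congr 2
      ext K
      simp only [bipartiteBelow, subspacesAvoiding, mem_filter, mem_univ, true_and, sup_le_iff,
        Submodule.span_singleton_le_iff_mem]
      exact ⟨fun ⟨⟨h1, h2⟩, h3⟩ => ⟨⟨h1, h3⟩, h2⟩, fun ⟨⟨h1, h3⟩, h2⟩ => ⟨⟨h1, h2⟩, h3⟩⟩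
    · simpa [hJ] using hxM
    · rw [← disjoint_iff, sup_comm]
      exact (disjoint_iff.2 hJU).disjoint_sup_left_of_disjoint_sup_right hd
    · have := Submodule.finrank_sup_add_finrank_inf_eq J (F ∙ x)
      rw [(hd.mono_right le_sup_left).symm.eq_bot, finrank_bot, finrank_span_singleton hx0] at this
      omega
  have hdc' := congrArg (Nat.cast (R := ℝ)) hdc
  push_cast at hdc'
  rw [sum_congr rfl h1, sum_congr rfl h2, sum_const, sum_const, nsmul_eq_mul, nsmul_eq_mul,
    card_sdiff_submodule (sup_le hJ hU), hsup] at hdc'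
  exact hdc'

lemma card_subspacesAvoiding {k : ℕ} {M U J : Submodule F V} (hU : U ≤ M) (hJ : J ≤ M)
    (hJU : J ⊓ U = ⊥) (hk : finrank F J ≤ k) :
    (#(subspacesAvoiding k M U J) : ℝ) = ∏ i ∈ Ico (finrank F J) k,
      ((Fintype.card F : ℝ) ^ finrank F M - (Fintype.card F : ℝ) ^ (finrank F U + i)) /
        ((Fintype.card F : ℝ) ^ k - (Fintype.card F : ℝ) ^ i) := by
  obtain ⟨d, hd⟩ := Nat.exists_eq_add_of_le hk
  induction d generalizing J with
  | zero =>
    have : subspacesAvoiding k M U J = {J} := by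
      ext K
      simp only [subspacesAvoiding, mem_filter, mem_univ, true_and, mem_singleton]
      constructor
      · rintro ⟨h, -, -, h'⟩
        exact (Submodule.eq_of_le_of_finrank_eq h (by omega)).symm
      · rintro rfl
        exact ⟨le_rfl, hJ, hJU, by omega⟩
    rw [this, hd]
    simp
  | succ d ih =>
    have hlt : finrank F J < k := by omega
    have hq : (1 : ℝ) < Fintype.card F := by exact_mod_cast Fintype.one_lt_card
    have := card_subspacesAvoiding_succ (k := k) hU hJ hJU (fun J' h1 h2 h3 => by
      have := ih h1 h2 (by omega) (by omega)
      rwa [h3] at this)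
    rw [prod_eq_prod_Ico_succ_bot hlt]
    have hpos : (Fintype.card F : ℝ) ^ k - (Fintype.card F : ℝ) ^ finrank F J ≠ 0 :=
      (sub_pos.2 (pow_lt_pow_right₀ hq hlt)).ne'
    rw [div_mul_eq_mul_div, ← this, mul_div_cancel_right₀ _ hpos]

/-- The value of the Möbius function of the subspace lattice on an interval of length `i`. -/
noncomputable def qMoebius (q : ℝ) (i : ℕ) : ℝ := (-1) ^ i * q ^ i.choose 2

lemma qMoebius_succ (q : ℝ) (i : ℕ) : qMoebius q (i + 1) = -(q ^ i * qMoebius q i) := by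
  simp only [qMoebius, Nat.choose_succ_succ' i 1, Nat.choose_one_right]
  ring

lemma card_complements_of_line {M L : Submodule F V} (hL : L ≤ M) (h1 : finrank F L = 1) {m : ℕ}
    (hm : finrank F M = m + 1) :
    (#(subspacesAvoiding m M L ⊥) : ℝ) = (Fintype.card F : ℝ) ^ m := by
  have hq : (1 : ℝ) < Fintype.card F := by exact_mod_cast Fintype.one_lt_card
  rw [card_subspacesAvoiding hL bot_le (bot_inf_eq _) (by simp), finrank_bot, hm, h1,
    ← range_eq_Ico, prod_congr rfl (g := fun _ => (Fintype.card F : ℝ)), prod_const, card_range]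
  intro i hi
  have : (Fintype.card F : ℝ) ^ m - (Fintype.card F : ℝ) ^ i ≠ 0 :=
    (sub_pos.2 (pow_lt_pow_right₀ hq (mem_range.1 hi))).ne'
  rw [div_eq_iff this]
  ring

lemma sum_qMoebius_le (Y : Submodule F V) :
    ∑ I : Submodule F V with I ≤ Y, qMoebius (Fintype.card F) (finrank F I) =
      if Y = ⊥ then 1 else 0 := by
  split_ifs with hY
  · subst hY
    simp [filter_eq', qMoebius]
  obtain ⟨x, hxY, hx0⟩ := Submodule.exists_mem_ne_zero_of_ne_bot hY
  set L := F ∙ x with hL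
  have hL1 : finrank F L = 1 := finrank_span_singleton hx0
  have hLY : L ≤ Y := by simpa [hL] using hxY
  have hdisj (I : Submodule F V) : I ⊓ L = ⊥ ↔ ¬ L ≤ I := by
    rw [← disjoint_iff, hL, Submodule.disjoint_span_singleton' hx0,
      Submodule.span_singleton_le_iff_mem]
  rw [← sum_filter_add_sum_filter_not _ (fun I => L ≤ I), filter_filter, filter_filter,
    ← sum_fiberwise_of_maps_to (s := ({I | I ≤ Y ∧ ¬ L ≤ I} : Finset (Submodule F V)))
      (t := ({I | I ≤ Y ∧ L ≤ I} : Finset (Submodule F V))) (g := fun I => I ⊔ L)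
      (by simp +contextual [hLY]), ← sum_add_distrib]
  refine sum_eq_zero fun M hM => ?_
  simp only [mem_filter, mem_univ, true_and] at hM
  obtain ⟨m, hm⟩ : ∃ m, finrank F M = m + 1 := by
    have := Submodule.finrank_mono hM.2
    exact ⟨finrank F M - 1, by omega⟩
  have hfin : ({I ∈ ({I | I ≤ Y ∧ ¬ L ≤ I} : Finset (Submodule F V)) | I ⊔ L = M}) =
      subspacesAvoiding m M L ⊥ := by
    ext I
    simp only [subspacesAvoiding, mem_filter, mem_univ, true_and, bot_le, ← hdisj]
    have hdim := Submodule.finrank_sup_add_finrank_inf_eq I L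
    constructor
    · rintro ⟨⟨h1, h2⟩, rfl⟩
      rw [h2, finrank_bot] at hdim
      exact ⟨le_sup_left, h2, by omega⟩
    · rintro ⟨h1, h2, h3⟩
      rw [h2, finrank_bot] at hdim
      exact ⟨⟨h1.trans hM.1, h2⟩, Submodule.eq_of_le_of_finrank_eq (sup_le h1 hM.2) (by omega)⟩
  rw [hfin, sum_congr rfl (g := fun _ => qMoebius (Fintype.card F) m), sum_const, nsmul_eq_mul,
    card_complements_of_line hM.2 hL1 hm, hm, qMoebius_succ]
  · ring
  · intro I hI
    simp only [subspacesAvoiding, mem_filter, mem_univ, true_and] at hI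
    rw [hI.2.2.2]

end

section
open Finset Matrix

/-- The ratio bound for independent sets. -/
lemma card_mul_le_of_eigenvalue_bound {ι : Type*} [Fintype ι] {A : Matrix ι ι ℝ}
    (hA : A.IsHermitian) {d τ : ℝ} (hd : A *ᵥ 1 = d • 1)
    (hτ : ∀ (x : ι → ℝ) (θ : ℝ), A *ᵥ x = θ • x → x ≠ 0 → x ⬝ᵥ 1 = 0 → -τ ≤ θ)
    {S : Finset ι} (hne : S.Nonempty) (hS : ∀ i ∈ S, ∀ j ∈ S, A i j = 0) :
    (#S : ℝ) * (d + τ) ≤ τ * Fintype.card ι := by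
  obtain ⟨i₀, hi₀⟩ := hne
  have hN : (0 : ℝ) < Fintype.card ι := by
    exact_mod_cast Fintype.card_pos_iff.2 ⟨i₀⟩
  have hSpos : (0 : ℝ) < #S := by exact_mod_cast card_pos.2 ⟨i₀, hi₀⟩
  set N : ℝ := (Fintype.card ι : ℝ) with hNdef
  have hone : (1 : ι → ℝ) ⬝ᵥ 1 = N := by simp [hNdef]
  set M : Matrix ι ι ℝ := A + τ • 1 - ((d + τ) / N) • Matrix.of (fun _ _ => 1) with hM
  have hMv (x : ι → ℝ) : M *ᵥ x = A *ᵥ x + τ • x - ((d + τ) / N * (x ⬝ᵥ 1)) • 1 := by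
    have hJ : Matrix.of (fun _ _ : ι => (1 : ℝ)) *ᵥ x = (x ⬝ᵥ 1) • 1 := by
      ext i
      simp [mulVec, dotProduct]
    rw [hM, sub_mulVec, add_mulVec, smul_mulVec, smul_mulVec, one_mulVec, hJ, smul_smul]
  have hMh : M.IsHermitian := by
    have hA' : Aᵀ = A := by simpa [IsHermitian, conjTranspose_eq_transpose_of_trivial] using hA
    rw [IsHermitian, conjTranspose_eq_transpose_of_trivial, hM]
    have hJ : (Matrix.of (fun _ _ : ι => (1 : ℝ)))ᵀ = Matrix.of (fun _ _ => 1) := rfl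
    rw [transpose_sub, transpose_add, transpose_smul, transpose_smul, transpose_one, hA', hJ]
  have hM1 : M *ᵥ 1 = 0 := by
    rw [hMv, hd, hone, div_mul_cancel₀ _ hN.ne', add_smul, sub_self]
  have hpos : M.PosSemidef := by
    rw [hMh.posSemidef_iff_eigenvalues_nonneg]
    intro i
    by_contra! hneg
    have hev := hMh.mulVec_eigenvectorBasis i
    have hx0 : (hMh.eigenvectorBasis i).ofLp ≠ 0 := by
      have := hMh.eigenvectorBasis.orthonormal.ne_zero i
      simpa using this
    generalize (hMh.eigenvectorBasis i).ofLp = x at hev hx0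
    generalize hMh.eigenvalues i = μ at hev hneg
    simp only [Pi.zero_apply] at hneg
    have hx1 : x ⬝ᵥ 1 = 0 := by
      have h1 : (M *ᵥ x) ⬝ᵥ 1 = 0 := by
        rw [dotProduct_comm, dotProduct_mulVec, ← mulVec_transpose,
          ← conjTranspose_eq_transpose_of_trivial, hMh.eq, hM1, zero_dotProduct]
      rw [hev, smul_dotProduct, smul_eq_mul] at h1
      exact (mul_eq_zero.1 h1).resolve_left hneg.ne
    have hAx : A *ᵥ x = (μ - τ) • x := by
      rw [hMv, hx1, mul_zero, zero_smul, sub_zero] at hev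
      rw [sub_smul, ← hev, add_sub_cancel_right]
    have := hτ x _ hAx hx0 hx1
    linarith
  set f : ι → ℝ := fun i => if i ∈ S then 1 else 0 with hf
  have hff : f ⬝ᵥ f = #S := by simp [hf, dotProduct]
  have hf1 : f ⬝ᵥ 1 = #S := by simp [hf, dotProduct]
  have hfA : f ⬝ᵥ (A *ᵥ f) = 0 := by
    simp only [dotProduct, mulVec, hf]
    refine sum_eq_zero fun i _ => ?_
    by_cases hi : i ∈ S
    · simp only [hi, if_true, one_mul]
      refine sum_eq_zero fun j _ => ?_
      by_cases hj : j ∈ S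
      · simp [hS i hi j hj]
      · simp [hj]
    · simp [hi]
  have h0 := hpos.dotProduct_mulVec_nonneg f
  rw [star_trivial, hMv, dotProduct_sub, dotProduct_add, hfA, dotProduct_smul, dotProduct_smul,
    hff, hf1, zero_add, smul_eq_mul, smul_eq_mul] at h0
  have h1 : (#S : ℝ) * ((d + τ) / N * #S) ≤ #S * τ := by linarith
  have h2 := le_of_mul_le_mul_left h1 hSpos
  rw [div_mul_eq_mul_div, div_le_iff₀ hN] at h2
  linarith

end

section
open Finset Module Matrix

variable {F V : Type*} [Field F] [AddCommGroup V] [Module F V]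

/-- The adjacency matrix of the q-Kneser graph. -/
noncomputable def kneserMatrix (F V : Type*) [Field F] [AddCommGroup V] [Module F V] (k : ℕ) :
    Matrix {U : Submodule F V // finrank F U = k} {U : Submodule F V // finrank F U = k} ℝ :=
  Matrix.of fun U W => if U.1 ⊓ W.1 = ⊥ then 1 else 0

/-- The indicator function of the `k`-subspaces containing `I`. -/
noncomputable def starIndicator (k : ℕ) (I : Submodule F V) :
    {U : Submodule F V // finrank F U = k} → ℝ :=
  fun U => if I ≤ U.1 then 1 else 0

/-- The span of the indicators of the stars of all subspaces of dimension at most `j`. -/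
noncomputable def starSpan (F V : Type*) [Field F] [AddCommGroup V] [Module F V] (k j : ℕ) :
    Submodule ℝ ({U : Submodule F V // finrank F U = k} → ℝ) :=
  Submodule.span ℝ (starIndicator k '' {I | finrank F I ≤ j})

lemma starIndicator_mem_starSpan {k j : ℕ} {I : Submodule F V} (hI : finrank F I ≤ j) :
    starIndicator k I ∈ starSpan F V k j :=
  Submodule.subset_span ⟨I, hI, rfl⟩

lemma starIndicator_bot (k : ℕ) : starIndicator k (⊥ : Submodule F V) = 1 := by
  ext; simp [starIndicator]

lemma kneserMatrix_isHermitian (k : ℕ) : (kneserMatrix F V k).IsHermitian := by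
  ext U W
  simp [kneserMatrix, inf_comm]

variable [Fintype V]

lemma starSpan_zero (k : ℕ) : starSpan F V k 0 = ℝ ∙ 1 := by
  have : {I : Submodule F V | finrank F I ≤ 0} = {⊥} := by
    ext I; simp
  rw [starSpan, this, Set.image_singleton, starIndicator_bot]

variable [Fintype (Submodule F V)]

lemma starSpan_self (k : ℕ) : starSpan F V k k = ⊤ := by
  rw [eq_top_iff, ← (Pi.basisFun ℝ _).span_eq, Submodule.span_le]
  rintro _ ⟨W, rfl⟩
  refine Submodule.subset_span ⟨W.1, W.2.le, ?_⟩
  ext U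
  simp only [starIndicator, Pi.basisFun_apply, Pi.single_apply]
  congr 1
  rw [eq_iff_iff]
  constructor
  · intro h
    exact Subtype.ext (Submodule.eq_of_le_of_finrank_eq h (W.2.trans U.2.symm)).symm
  · rintro rfl
    exact le_rfl

variable [Fintype F]

/-- In a `v`-space over a field of order `q`, the number of `k`-subspaces containing a given
`j`-space and disjoint from a given `k`-space disjoint from that `j`-space. -/
noncomputable def disjointCount (q : ℝ) (v k j : ℕ) : ℝ :=
  ∏ i ∈ Ico j k, (q ^ v - q ^ (k + i)) / (q ^ k - q ^ i)

lemma sum_qMoebius_mul_starIndicator {k : ℕ} (I : Submodule F V)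
    (U : {U : Submodule F V // finrank F U = k}) :
    ∑ I' : Submodule F V with I' ≤ I,
        qMoebius (Fintype.card F) (finrank F I') * starIndicator k I' U =
      if I ⊓ U.1 = ⊥ then 1 else 0 := by
  rw [← sum_qMoebius_le]
  simp only [starIndicator, mul_ite, mul_one, mul_zero]
  rw [← sum_filter, filter_filter]
  simp only [le_inf_iff]

lemma kneserMatrix_mulVec_starIndicator {k : ℕ} {I : Submodule F V} (hI : finrank F I ≤ k) :
    kneserMatrix F V k *ᵥ starIndicator k I =
      ∑ I' : Submodule F V with I' ≤ I,
        (disjointCount (Fintype.card F) (finrank F V) k (finrank F I) *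
          qMoebius (Fintype.card F) (finrank F I')) • starIndicator k I' := by
  ext U
  simp only [Finset.sum_apply, Pi.smul_apply, smul_eq_mul, mul_assoc]
  rw [← mul_sum, sum_qMoebius_mul_starIndicator]
  have h1 : (kneserMatrix F V k *ᵥ starIndicator k I) U = #(subspacesAvoiding k ⊤ U.1 I) := by
    simp only [mulVec, dotProduct, kneserMatrix, starIndicator, Matrix.of_apply]
    rw [← Finset.sum_subtype ({W | finrank F W = k} : Finset (Submodule F V)) (by simp)
      (fun W => (if U.1 ⊓ W = ⊥ then (1 : ℝ) else 0) * if I ≤ W then 1 else 0)]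
    simp only [mul_ite, mul_one, mul_zero]
    rw [← sum_filter, ← sum_filter, sum_const, nsmul_eq_mul, mul_one, filter_filter,
      filter_filter, subspacesAvoiding]
    congr 2
    ext W
    simp only [mem_filter, mem_univ, true_and, le_top, inf_comm U.1 W]
    tauto
  rw [h1]
  split_ifs with h
  · rw [card_subspacesAvoiding le_top le_top h hI, finrank_top, U.2, mul_one, disjointCount]
  · rw [mul_zero, Nat.cast_eq_zero, card_eq_zero, subspacesAvoiding, filter_eq_empty_iff]
    rintro W - ⟨hIW, -, hWU, -⟩
    exact h (eq_bot_iff.2 ((inf_le_inf_right _ hIW).trans hWU.le))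

/-- The eigenvalues of the q-Kneser graph. -/
noncomputable def kneserEigenvalue (q : ℝ) (v k j : ℕ) : ℝ :=
  disjointCount q v k j * qMoebius q j

lemma kneserMatrix_mulVec_sub_mem_starSpan {k j : ℕ} (hj : j + 1 ≤ k)
    {x : {U : Submodule F V // finrank F U = k} → ℝ} (hx : x ∈ starSpan F V k (j + 1)) :
    kneserMatrix F V k *ᵥ x -
      kneserEigenvalue (Fintype.card F) (finrank F V) k (j + 1) • x ∈ starSpan F V k j := by
  induction hx using Submodule.span_induction with
  | mem x hx =>
    obtain ⟨I, hI, rfl⟩ := hx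
    simp only [Set.mem_ofPred_eq] at hI
    rw [kneserMatrix_mulVec_starIndicator (hI.trans hj)]
    rcases hI.lt_or_eq with hlt | heq
    · refine sub_mem (sum_mem fun I' hI' => Submodule.smul_mem _ _ ?_)
        (Submodule.smul_mem _ _ ?_)
      · have := Submodule.finrank_mono (mem_filter.1 hI').2
        exact starIndicator_mem_starSpan (by omega)
      · exact starIndicator_mem_starSpan (by omega)
    · rw [← add_sum_erase _ _ (by simp : I ∈ ({I' | I' ≤ I} : Finset (Submodule F V))), heq,
        kneserEigenvalue, add_sub_cancel_left]
      refine sum_mem fun I' hI' => Submodule.smul_mem _ _ (starIndicator_mem_starSpan ?_)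
      simp only [mem_erase, mem_filter, mem_univ, true_and] at hI'
      have := Submodule.finrank_lt_finrank_of_lt (lt_of_le_of_ne hI'.2 hI'.1)
      omega
  | zero => simp
  | add x y _ _ hx hy =>
    rw [mulVec_add, smul_add, add_sub_add_comm]
    exact add_mem hx hy
  | smul a x _ hx =>
    rw [mulVec_smul, smul_comm, ← smul_sub]
    exact Submodule.smul_mem _ _ hx

lemma mem_starSpan_of_eigenvector {k : ℕ} {x : {U : Submodule F V // finrank F U = k} → ℝ} {θ : ℝ}
    (hx : kneserMatrix F V k *ᵥ x = θ • x)
    (hθ : ∀ j < k, θ ≠ kneserEigenvalue (Fintype.card F) (finrank F V) k (j + 1)) :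
    ∀ j ≤ k, x ∈ starSpan F V k (k - j)
  | 0, _ => by rw [Nat.sub_zero, starSpan_self]; trivial
  | j + 1, hj => by
    have ih := mem_starSpan_of_eigenvector hx hθ j (by omega)
    have hkj : k - j = k - (j + 1) + 1 := by omega
    rw [hkj] at ih
    have h := kneserMatrix_mulVec_sub_mem_starSpan (by omega) ih
    rw [hx, ← sub_smul] at h
    exact (Submodule.smul_mem_iff _ (sub_ne_zero.2 (hθ _ (by omega)))).1 h

lemma eq_kneserEigenvalue_of_eigenvector {k : ℕ}
    {x : {U : Submodule F V // finrank F U = k} → ℝ} {θ : ℝ}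
    (hx : kneserMatrix F V k *ᵥ x = θ • x) (hx0 : x ≠ 0) (hx1 : x ⬝ᵥ 1 = 0) :
    ∃ j < k, θ = kneserEigenvalue (Fintype.card F) (finrank F V) k (j + 1) := by
  by_contra! h
  have hmem := mem_starSpan_of_eigenvector hx h k le_rfl
  rw [Nat.sub_self, starSpan_zero, Submodule.mem_span_singleton] at hmem
  obtain ⟨a, rfl⟩ := hmem
  have : (a • 1 : {U : Submodule F V // finrank F U = k} → ℝ) ⬝ᵥ (a • 1) = 0 := by
    rw [dotProduct_smul, hx1, smul_zero]
  exact hx0 (dotProduct_self_eq_zero.1 this)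

section Arithmetic

variable {q : ℝ} {v k : ℕ}

lemma disjointCount_eq_mul_succ {j : ℕ} (hj : j < k) :
    disjointCount q v k j =
      (q ^ v - q ^ (k + j)) / (q ^ k - q ^ j) * disjointCount q v k (j + 1) := by
  rw [disjointCount, prod_eq_prod_Ico_succ_bot hj, disjointCount]

lemma disjointCount_nonneg (hq : 2 ≤ q) (hvk : 2 * k ≤ v) (j : ℕ) :
    0 ≤ disjointCount q v k j := by
  refine prod_nonneg fun i hi => ?_
  have hik := (mem_Ico.1 hi).2
  have h1 : q ^ (k + i) ≤ q ^ v := pow_le_pow_right₀ (by linarith) (by omega)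
  have h2 : q ^ i ≤ q ^ k := pow_le_pow_right₀ (by linarith) (by omega)
  exact div_nonneg (by linarith) (by linarith)

lemma pow_mul_disjointCount_succ_le (hq : 2 ≤ q) (hvk : 2 * k ≤ v) {j : ℕ} (hj : j < k) :
    q ^ j * disjointCount q v k (j + 1) ≤ disjointCount q v k j := by
  rw [disjointCount_eq_mul_succ hj]
  refine mul_le_mul_of_nonneg_right ?_ (disjointCount_nonneg hq hvk _)
  have h2 : 0 < q ^ k - q ^ j := sub_pos.2 (pow_lt_pow_right₀ (by linarith) hj)
  rw [le_div_iff₀ h2]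
  have h3 : q ^ (k + j + 1) ≤ q ^ v := pow_le_pow_right₀ (by linarith) (by omega)
  have h4 : 0 ≤ q ^ (k + j) := by positivity
  have h5 : 0 ≤ q ^ j * q ^ j := by positivity
  rw [pow_succ] at h3
  rw [mul_sub, ← pow_add q j k, add_comm j k]
  nlinarith

lemma abs_kneserEigenvalue_succ_le (hq : 2 ≤ q) (hvk : 2 * k ≤ v) {j : ℕ} (hj : j < k) :
    |kneserEigenvalue q v k (j + 1)| ≤ disjointCount q v k 1 := by
  have habs (i : ℕ) : |kneserEigenvalue q v k i| = disjointCount q v k i * q ^ i.choose 2 := by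
    rw [kneserEigenvalue, qMoebius, abs_mul, abs_mul, abs_pow, abs_neg, abs_one, one_pow, one_mul,
      abs_of_nonneg (disjointCount_nonneg hq hvk i), abs_of_nonneg (by positivity)]
  induction j with
  | zero => simp [habs]
  | succ j ih =>
    refine le_trans ?_ (ih (by omega))
    rw [habs, habs, Nat.choose_succ_succ' (j + 1) 1, Nat.choose_one_right, pow_add]
    have := pow_mul_disjointCount_succ_le hq hvk hj
    have h : 0 ≤ q ^ (j + 1).choose 2 := by positivity
    nlinarith [mul_le_mul_of_nonneg_right this h]

end Arithmetic

lemma kneserMatrix_mulVec_one (k : ℕ) :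
    kneserMatrix F V k *ᵥ 1 = disjointCount (Fintype.card F) (finrank F V) k 0 • 1 := by
  have := kneserMatrix_mulVec_starIndicator (k := k) (I := (⊥ : Submodule F V)) (by simp)
  simpa [starIndicator_bot, filter_eq', qMoebius] using this

lemma card_filter_le_subspace {k : ℕ} {J : Submodule F V} (hJ : finrank F J ≤ k) :
    (#{U : {U : Submodule F V // finrank F U = k} | J ≤ U.1} : ℝ) =
      ∏ i ∈ Ico (finrank F J) k,
        ((Fintype.card F : ℝ) ^ finrank F V - (Fintype.card F : ℝ) ^ i) /
          ((Fintype.card F : ℝ) ^ k - (Fintype.card F : ℝ) ^ i) := by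
  have h := card_subspacesAvoiding (k := k) (M := ⊤) (U := ⊥) (J := J) bot_le le_top
    (inf_bot_eq _) hJ
  simp only [finrank_top, finrank_bot, zero_add] at h
  rw [← h, Nat.cast_inj, ← card_map (Function.Embedding.subtype _)]
  congr 1
  ext W
  simp [subspacesAvoiding]

end

lemma eq_gaussBinomial_of_cast_eq_prod {q v k : ℕ} (hq : 2 ≤ q) (hk : 1 ≤ k) (hvk : k ≤ v) {n : ℕ}
    (hn : (n : ℝ) = ∏ i ∈ Finset.Ico 1 k,
      ((q : ℝ) ^ v - (q : ℝ) ^ i) / ((q : ℝ) ^ k - (q : ℝ) ^ i)) :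
    n = gaussBinomial q (v - 1) (k - 1) := by
  have hq' : (2 : ℝ) ≤ q := by exact_mod_cast hq
  have hcast (m : ℕ) : ((q ^ m - 1 : ℕ) : ℝ) = (q : ℝ) ^ m - 1 := by
    rw [Nat.cast_sub (Nat.one_le_pow _ _ (by omega))]; simp
  have hden : 0 < ∏ i ∈ Finset.range (k - 1), (q ^ (i + 1) - 1) :=
    Finset.prod_pos fun i _ => Nat.sub_pos_of_lt (Nat.one_lt_pow (by omega) (by omega))
  rw [gaussBinomial]
  symm
  apply Nat.div_eq_of_eq_mul_left hden
  rw [← Nat.cast_inj (R := ℝ)]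
  push_cast [hcast]
  have hrefl : ∏ i ∈ Finset.range (k - 1), ((q : ℝ) ^ (i + 1) - 1) =
      ∏ i ∈ Finset.range (k - 1), ((q : ℝ) ^ (k - 1 - i) - 1) := by
    rw [← Finset.prod_range_reflect]
    refine Finset.prod_congr rfl fun i hi => ?_
    have := Finset.mem_range.1 hi
    congr 2
    omega
  rw [hrefl, hn, Finset.prod_Ico_eq_prod_range, ← Finset.prod_mul_distrib]
  refine Finset.prod_congr rfl fun i hi => ?_
  have := Finset.mem_range.1 hi
  have h1 : (q : ℝ) ^ v = q ^ (v - 1 - i) * q ^ (1 + i) := by rw [← pow_add]; congr 1; omega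
  have h2 : (q : ℝ) ^ k = q ^ (k - 1 - i) * q ^ (1 + i) := by rw [← pow_add]; congr 1; omega
  have h3 : (0 : ℝ) < q ^ (1 + i) := by positivity
  have h4 : (0 : ℝ) < q ^ (k - 1 - i) - 1 :=
    sub_pos.2 (one_lt_pow₀ (by linarith) (by omega))
  rw [h1, h2, ← sub_one_mul, ← sub_one_mul, mul_div_mul_right _ _ h3.ne', div_mul_cancel₀ _ h4.ne']

/-- The independence number of the q-Kneser graph `qK_{v:k}` is
`[v−1 choose k−1]_q`, attained by the star of a fixed 1-dimensional subspace. -/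
theorem qKneser_independence_number
    (q : ℕ) (F : Type*) [Field F] [Fintype F] (hq : Fintype.card F = q)
    (v k : ℕ) (hk : 1 ≤ k) (hvk : 2 * k ≤ v) :
    (∀ S : Set (qKneserVert F v k), qKneserIndep S →
        S.ncard ≤ gaussBinomial q (v - 1) (k - 1)) ∧
    (∀ ℓ : Submodule F (Fin v → F), Module.finrank F ℓ = 1 →
        qKneserIndep {U : qKneserVert F v k | ℓ ≤ U.1} ∧
        {U : qKneserVert F v k | ℓ ≤ U.1}.ncard = gaussBinomial q (v - 1) (k - 1)) := by
  let _ : Fintype (Submodule F (Fin v → F)) := Fintype.ofFinite _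
  have hq2 : 2 ≤ q := hq ▸ Fintype.one_lt_card
  have hq2' : (2 : ℝ) ≤ q := by exact_mod_cast hq2
  have hv : Module.finrank F (Fin v → F) = v := by simp
  have hstar (ℓ : Submodule F (Fin v → F)) (hℓ : Module.finrank F ℓ = 1) :
      {U : qKneserVert F v k | ℓ ≤ U.1}.ncard = gaussBinomial q (v - 1) (k - 1) := by
    have h := card_filter_le_subspace (k := k) (J := ℓ) (by omega)
    rw [hℓ, hv, hq] at h
    rw [← eq_gaussBinomial_of_cast_eq_prod hq2 hk (by omega) h, Set.ncard_eq_toFinset_card']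
    congr 1
    ext; simp
  refine ⟨fun S hS => ?_, fun ℓ hℓ => ⟨fun U hU W hW _ h => ?_, hstar ℓ hℓ⟩⟩
  swap
  · have hbot : ℓ ≤ ⊥ := h ▸ le_inf hU hW
    rw [le_bot_iff.1 hbot, finrank_bot] at hℓ
    omega
  rcases S.eq_empty_or_nonempty with rfl | hne
  · simp
  have hdiag (U : qKneserVert F v k) : U.1 ⊓ U.1 ≠ ⊥ := by
    intro h
    have := U.2
    rw [inf_idem] at h
    rw [h, finrank_bot] at this
    omega
  have hbound := card_mul_le_of_eigenvalue_bound (S := S.toFinset)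
    (kneserMatrix_isHermitian (F := F) (V := Fin v → F) k) (kneserMatrix_mulVec_one k)
    (τ := disjointCount q v k 1)
    (fun x θ hx hx0 hx1 => by
      obtain ⟨j, hj, rfl⟩ := eq_kneserEigenvalue_of_eigenvector hx hx0 hx1
      rw [hv, hq]
      exact (abs_le.1 (abs_kneserEigenvalue_succ_le hq2' hvk hj)).1)
    (by simpa using hne)
    (fun U hU W hW => by
      rw [Set.mem_toFinset] at hU hW
      rw [kneserMatrix, Matrix.of_apply, if_neg]
      by_cases h : U = W
      · exact h ▸ hdiag U
      · exact hS U hU W hW h)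
  rw [hv, hq, disjointCount_eq_mul_succ (by omega : 0 < k)] at hbound
  have hτ : 0 < disjointCount q v k 1 := by
    refine Finset.prod_pos fun i hi => div_pos ?_ ?_ <;> rw [Finset.mem_Ico] at hi <;>
      exact sub_pos.2 (pow_lt_pow_right₀ (by linarith) (by omega))
  have hcard := card_filter_le_subspace (F := F) (V := Fin v → F) (k := k) (J := ⊥) (by simp)
  obtain ⟨n, hn⟩ : ∃ n : ℕ, (n : ℝ) =
      ∏ i ∈ Finset.Ico 1 k, ((q : ℝ) ^ v - (q : ℝ) ^ i) / ((q : ℝ) ^ k - (q : ℝ) ^ i) := by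
    let ℓ : Submodule F (Fin v → F) := F ∙ fun _ => (1 : F)
    have hℓ : Module.finrank F ℓ = 1 :=
      finrank_span_singleton fun h => one_ne_zero (congrFun h ⟨0, by omega⟩)
    have h := card_filter_le_subspace (k := k) (J := ℓ) (by omega)
    rw [hℓ, hv, hq] at h
    exact ⟨_, h⟩
  simp only [bot_le, Finset.filter_true, Finset.card_univ, finrank_bot, hv, hq] at hcard
  rw [Finset.prod_eq_prod_Ico_succ_bot (by omega : 0 < k), zero_add, ← hn] at hcard
  rw [hcard] at hbound
  rw [← eq_gaussBinomial_of_cast_eq_prod hq2 hk (by omega) hn, Set.ncard_eq_toFinset_card',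
    ← Nat.cast_le (α := ℝ)]
  simp only [zero_add, add_zero, pow_zero] at hbound
  have hk1 : (0 : ℝ) < q ^ k - 1 := sub_pos.2 (one_lt_pow₀ (by linarith) (by omega))
  have hkv : (0 : ℝ) < q ^ v - 1 := sub_pos.2 (one_lt_pow₀ (by linarith) (by omega))
  have key : ((q : ℝ) ^ v - q ^ k) / (q ^ k - 1) * disjointCount q v k 1 + disjointCount q v k 1 =
      disjointCount q v k 1 * ((q ^ v - 1) / (q ^ k - 1)) := by
    field_simp
    ring
  rw [key, mul_left_comm] at hbound
  have := le_of_mul_le_mul_left hbound hτ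
  rw [mul_comm] at this
  exact le_of_mul_le_mul_left this (div_pos hkv hk1)
end

section
/- (Hsieh's theorem) Let v > 2k ≥ 2. If S is an independent set of maximum size [v−1 choose k−1]_q in the q-Kneser graph qK_{v:k}, then there is a 1-dimensional subspace ℓ of GF(q)^v such that S consists exactly of the k-subspaces containing ℓ. -/
open scoped Classical

open Module

namespace QKneser

section Scalars

/-- The number of `k`-subspaces of an `n`-space that contain a fixed `j`-subspace and avoid a fixed
`d`-subspace, over a field with `q` elements. -/
noncomputable def avoidCount (q : ℝ) (n k d j : ℕ) : ℝ :=
  ∏ i ∈ Finset.Ico j k, (q ^ n - q ^ (i + d)) / (q ^ k - q ^ i)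

theorem avoidCount_self (q : ℝ) (n k d : ℕ) : avoidCount q n k d k = 1 := by
  simp [avoidCount]

theorem avoidCount_succ {q : ℝ} (hq : 1 < q) {n k d j : ℕ} (hj : j < k) :
    avoidCount q n k d j * (q ^ k - q ^ j) =
      (q ^ n - q ^ (j + d)) * avoidCount q n k d (j + 1) := by
  have : q ^ k - q ^ j ≠ 0 := (sub_pos.2 (pow_lt_pow_right₀ hq hj)).ne'
  rw [avoidCount, Finset.prod_eq_prod_Ico_succ_bot hj, avoidCount]
  field_simp

theorem avoidCount_pos {q : ℝ} (hq : 1 < q) {n k d j : ℕ} (h : k + d ≤ n) :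
    0 < avoidCount q n k d j := by
  refine Finset.prod_pos fun i hi => ?_
  have := Finset.mem_Ico.1 hi
  exact div_pos (sub_pos.2 (pow_lt_pow_right₀ hq (by omega)))
    (sub_pos.2 (pow_lt_pow_right₀ hq (by omega)))

theorem avoidCount_hyperplane {q : ℝ} (hq : 1 < q) (i : ℕ) :
    avoidCount q (i + 1) i 1 0 = q ^ i := by
  rw [avoidCount, Finset.prod_congr rfl (g := fun _ => q)]
  · simp
  · intro l hl
    have : q ^ i - q ^ l ≠ 0 :=
      (sub_pos.2 (pow_lt_pow_right₀ hq (Finset.mem_Ico.1 hl).2)).ne'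
    field_simp
    ring

/-- The Möbius function of the lattice of subspaces of a vector space over a field with `q`
elements, on an interval of length `i`. -/
noncomputable def subspaceMoebius (q : ℝ) (i : ℕ) : ℝ := ∏ l ∈ Finset.range i, -(q ^ l)

theorem subspaceMoebius_succ (q : ℝ) (i : ℕ) :
    subspaceMoebius q (i + 1) = -(q ^ i * subspaceMoebius q i) := by
  rw [subspaceMoebius, Finset.prod_range_succ, subspaceMoebius]
  ring

/-- The eigenvalue of the q-Kneser graph on the image of the harmonic functions on `j`-subspaces. -/
noncomputable def kneserEigenvalue (q : ℝ) (n k j : ℕ) : ℝ :=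
  avoidCount q n k k j * subspaceMoebius q j

theorem exists_orthogonal_decomposition {ι : Type*} (s : Finset ι) (M : Submodule ℝ (ι → ℝ))
    (g : ι → ℝ) : ∃ m ∈ M, ∀ m' ∈ M, ∑ i ∈ s, m' i * (g i - m i) = 0 := by
  let r : (ι → ℝ) →ₗ[ℝ] EuclideanSpace ℝ s :=
    (WithLp.linearEquiv 2 ℝ (s → ℝ)).symm.toLinearMap ∘ₗ LinearMap.funLeft ℝ ℝ ((↑) : s → ι)
  have hr (f : ι → ℝ) (i : s) : r f i = f i := rfl
  obtain ⟨y, ⟨m, hm, rfl⟩, z, hz, h⟩ := (M.map r).exists_add_mem_mem_orthogonal (r g)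
  refine ⟨m, hm, fun m' hm' => ?_⟩
  have := (Submodule.mem_orthogonal _ _).1 hz (r m') ⟨m', hm', rfl⟩
  rw [eq_sub_of_add_eq' h.symm] at this
  rw [← Finset.sum_coe_sort]
  simpa [PiLp.inner_apply, hr, mul_comm] using this

theorem subspaceMoebius_ne_zero {q : ℝ} (hq : 0 < q) (i : ℕ) : subspaceMoebius q i ≠ 0 :=
  Finset.prod_ne_zero_iff.2 fun l _ => neg_ne_zero.2 (pow_pos hq l).ne'

theorem abs_kneserEigenvalue_succ_lt {q : ℝ} (hq : 2 ≤ q) {n k j : ℕ} (hn : 2 * k < n)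
    (hj : j < k) : |kneserEigenvalue q n k (j + 1)| < |kneserEigenvalue q n k j| := by
  have hq1 : 1 < q := by linarith
  have hpos (i : ℕ) : 0 < q ^ i := pow_pos (by linarith) i
  have hrec : kneserEigenvalue q n k (j + 1) * (q ^ n - q ^ (j + k)) =
      kneserEigenvalue q n k j * -((q ^ k - q ^ j) * q ^ j) := by
    rw [kneserEigenvalue, kneserEigenvalue, subspaceMoebius_succ]
    linear_combination (subspaceMoebius q j * q ^ j) * avoidCount_succ (n := n) (d := k) hq1 hj
  have hτ : 0 < |kneserEigenvalue q n k j| := abs_pos.2 (mul_ne_zero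
    (avoidCount_pos hq1 (by omega)).ne' (subspaceMoebius_ne_zero (by linarith) j))
  have hn1 : q * q ^ (j + k) ≤ q ^ n := by
    rw [← pow_succ']
    exact pow_le_pow_right₀ hq1.le (by omega)
  have hn2 : 2 * q ^ (j + k) ≤ q ^ n :=
    (mul_le_mul_of_nonneg_right hq (hpos _).le).trans hn1
  have hD : 0 < q ^ n - q ^ (j + k) := by linarith [hpos (j + k)]
  have hE : 0 < (q ^ k - q ^ j) * q ^ j :=
    mul_pos (sub_pos.2 (pow_lt_pow_right₀ hq1 hj)) (hpos j)
  have hED : (q ^ k - q ^ j) * q ^ j < q ^ n - q ^ (j + k) := by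
    rw [pow_add] at hn2 ⊢
    nlinarith [hpos j]
  have habs := congrArg abs hrec
  rw [abs_mul, abs_mul, abs_neg, abs_of_pos hD, abs_of_pos hE] at habs
  refine lt_of_mul_lt_mul_right ?_ hD.le
  rw [habs]
  exact mul_lt_mul_of_pos_left hED hτ

theorem abs_kneserEigenvalue_lt {q : ℝ} (hq : 2 ≤ q) {n k i j : ℕ} (hn : 2 * k < n)
    (hij : i < j) (hj : j ≤ k) : |kneserEigenvalue q n k j| < |kneserEigenvalue q n k i| := by
  induction j, hij using Nat.le_induction with
  | base => exact abs_kneserEigenvalue_succ_lt hq hn hj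
  | succ j _ ih => exact (abs_kneserEigenvalue_succ_lt hq hn hj).trans (ih (by omega))

end Scalars

section Subspaces

variable {F V : Type*} [Field F] [AddCommGroup V] [Module F V]

theorem sup_span_singleton_inf_eq_bot {T U : Submodule F V} (hTU : T ⊓ U = ⊥) {x : V}
    (hx : x ∉ T ⊔ U) : (T ⊔ Submodule.span F {x}) ⊓ U = ⊥ := by
  rw [eq_bot_iff]
  rintro y ⟨hy, hyU⟩
  obtain ⟨t, ht, z, hz, rfl⟩ := Submodule.mem_sup.1 hy
  obtain ⟨a, rfl⟩ := Submodule.mem_span_singleton.1 hz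
  by_cases ha : a = 0
  · subst ha
    rw [← hTU]
    simpa using ⟨ht, by simpa using hyU⟩
  · refine absurd ?_ hx
    have h1 : a • x ∈ T ⊔ U := by
      have := Submodule.sub_mem _ (Submodule.mem_sup_right hyU : _ ∈ T ⊔ U)
        (Submodule.mem_sup_left ht)
      simpa using this
    simpa [smul_smul, ha] using Submodule.smul_mem _ a⁻¹ h1

theorem finrank_sup_span_singleton [FiniteDimensional F V] {T : Submodule F V} {x : V}
    (hx : x ∉ T) : finrank F ↥(T ⊔ Submodule.span F {x}) = finrank F T + 1 := by
  have h := Submodule.finrank_sup_add_finrank_inf_eq T (Submodule.span F {x})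
  have h0 : x ≠ 0 := by rintro rfl; exact hx T.zero_mem
  have hd : T ⊓ Submodule.span F {x} = ⊥ := by
    rw [← disjoint_iff, Submodule.disjoint_span_singleton' h0]
    exact hx
  rw [hd, finrank_bot, finrank_span_singleton h0] at h
  simpa using h

theorem one_lt_card_real (F : Type*) [Field F] [Fintype F] : (1 : ℝ) < Fintype.card F := by
  exact_mod_cast Fintype.one_lt_card

theorem two_le_card_real (F : Type*) [Field F] [Fintype F] : (2 : ℝ) ≤ Fintype.card F := by
  exact_mod_cast Fintype.one_lt_card (α := F)

theorem sum_indicator_sdiff [Fintype F] [Fintype V] {T U : Submodule F V} (h : T ≤ U) :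
    (∑ x : V, if x ∈ U ∧ x ∉ T then (1 : ℝ) else 0) =
      (Fintype.card F : ℝ) ^ finrank F U - (Fintype.card F : ℝ) ^ finrank F T := by
  have hc (W : Submodule F V) : (∑ x : V, if x ∈ W then (1 : ℝ) else 0) =
      (Fintype.card F : ℝ) ^ finrank F W := by
    rw [Finset.sum_boole, ← Nat.cast_pow, ← Module.card_eq_pow_finrank (K := F) (V := W),
      Fintype.card_subtype]
  rw [← hc, ← hc, ← Finset.sum_sub_distrib]
  refine Finset.sum_congr rfl fun x _ => ?_
  by_cases h1 : x ∈ U <;> by_cases h2 : x ∈ T <;> simp [h1, h2]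
  exact h1 (h h2)

variable [Fintype (Submodule F V)]

/-- The finset of `k`-dimensional subspaces of `V`. -/
noncomputable def grass (F V : Type*) [Field F] [AddCommGroup V] [Module F V]
    [Fintype (Submodule F V)] (k : ℕ) : Finset (Submodule F V) :=
  {U | finrank F U = k}

theorem mem_grass {k : ℕ} {U : Submodule F V} : U ∈ grass F V k ↔ finrank F U = k := by
  simp [grass]

/-- The function on subspaces that sums `g` over the `j`-subspaces of its argument. -/
noncomputable def sumBelow (j : ℕ) (g : Submodule F V → ℝ) (U : Submodule F V) : ℝ :=
  ∑ T ∈ grass F V j, if T ≤ U then g T else 0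

theorem sumBelow_zero (j : ℕ) : sumBelow j (0 : Submodule F V → ℝ) = 0 := by
  ext U
  simp [sumBelow]

theorem sumBelow_add (j : ℕ) (g h : Submodule F V → ℝ) :
    sumBelow j (g + h) = sumBelow j g + sumBelow j h := by
  ext U
  simp only [sumBelow, Pi.add_apply, ← Finset.sum_add_distrib]
  refine Finset.sum_congr rfl fun T _ => ?_
  split_ifs <;> simp

theorem sumBelow_smul (j : ℕ) (c : ℝ) (g : Submodule F V → ℝ) :
    sumBelow j (c • g) = c • sumBelow j g := by
  ext U
  simp only [sumBelow, Pi.smul_apply, smul_eq_mul, Finset.mul_sum, mul_ite, mul_zero]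

/-- `g` is harmonic on the `j`-subspaces if its sum over those containing any fixed subspace of
smaller dimension vanishes. -/
def IsHarmonic (j : ℕ) (g : Submodule F V → ℝ) : Prop :=
  ∀ R : Submodule F V, finrank F R < j → (∑ T ∈ grass F V j, if R ≤ T then g T else 0) = 0

theorem IsHarmonic.zero (j : ℕ) : IsHarmonic j (0 : Submodule F V → ℝ) := fun R _ => by simp

theorem IsHarmonic.add {j : ℕ} {g h : Submodule F V → ℝ} (hg : IsHarmonic j g)
    (hh : IsHarmonic j h) : IsHarmonic j (g + h) := fun R hR => by
  have := congrArg₂ (· + ·) (hg R hR) (hh R hR)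
  simp only [← Finset.sum_add_distrib, add_zero] at this
  refine (Finset.sum_congr rfl fun T _ => ?_).trans this
  split_ifs <;> simp

theorem IsHarmonic.smul {j : ℕ} (c : ℝ) {g : Submodule F V → ℝ} (hg : IsHarmonic j g) :
    IsHarmonic j (c • g) := fun R hR => by
  have := congrArg (c * ·) (hg R hR)
  simpa [Finset.mul_sum] using this

/-- The adjacency operator of the q-Kneser graph on `k`-subspaces. -/
noncomputable def kneserAdj (k : ℕ) (f : Submodule F V → ℝ) (U : Submodule F V) : ℝ :=
  ∑ W ∈ grass F V k, if W ⊓ U = ⊥ then f W else 0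

theorem sum_mul_kneserAdj (k : ℕ) (f g : Submodule F V → ℝ) :
    ∑ U ∈ grass F V k, f U * kneserAdj k g U = ∑ U ∈ grass F V k, kneserAdj k f U * g U := by
  simp only [kneserAdj, Finset.mul_sum, Finset.sum_mul]
  rw [Finset.sum_comm]
  refine Finset.sum_congr rfl fun U _ => Finset.sum_congr rfl fun W _ => ?_
  rw [inf_comm]
  split_ifs <;> simp

/-- Functions that agree on the `k`-subspaces with a sum of images of harmonic functions. -/
def harmonicSums (F V : Type*) [Field F] [AddCommGroup V] [Module F V] [Fintype (Submodule F V)]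
    (k : ℕ) : Submodule ℝ (Submodule F V → ℝ) where
  carrier := {f | ∃ g : ℕ → Submodule F V → ℝ, (∀ j, IsHarmonic j (g j)) ∧
    ∀ U ∈ grass F V k, f U = ∑ j ∈ Finset.range (k + 1), sumBelow j (g j) U}
  zero_mem' := ⟨0, fun j => IsHarmonic.zero j, fun U _ => by simp [sumBelow_zero]⟩
  add_mem' := by
    rintro _ _ ⟨g, hg, hgf⟩ ⟨h, hh, hhf⟩
    refine ⟨g + h, fun j => (hg j).add (hh j), fun U hU => ?_⟩
    simp [hgf U hU, hhf U hU, sumBelow_add, Finset.sum_add_distrib]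
  smul_mem' := by
    rintro c _ ⟨g, hg, hgf⟩
    refine ⟨c • g, fun j => (hg j).smul c, fun U hU => ?_⟩
    simp [hgf U hU, sumBelow_smul, Finset.mul_sum]

theorem harmonicSums_congr {k : ℕ} {f f' : Submodule F V → ℝ} (hf : f ∈ harmonicSums F V k)
    (h : ∀ U ∈ grass F V k, f' U = f U) : f' ∈ harmonicSums F V k := by
  obtain ⟨g, hg, hgf⟩ := hf
  exact ⟨g, hg, fun U hU => (h U hU).trans (hgf U hU)⟩

theorem IsHarmonic.sumBelow_mem {j k : ℕ} (hjk : j ≤ k) {g : Submodule F V → ℝ}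
    (hg : IsHarmonic j g) : sumBelow j g ∈ harmonicSums F V k := by
  refine ⟨fun i => if i = j then g else 0, fun i => ?_, fun U _ => ?_⟩
  · by_cases h : i = j
    · subst h
      simpa using hg
    · simpa [h] using IsHarmonic.zero i
  · rw [Finset.sum_eq_single j]
    · simp
    · intro i _ hi
      simp [hi, sumBelow_zero]
    · intro h
      exact absurd (Finset.mem_range.2 (by omega)) h

theorem kneserAdj_sum (k : ℕ) {ι : Type*} (s : Finset ι) {f : Submodule F V → ℝ}
    {h : ι → Submodule F V → ℝ} (hf : ∀ U ∈ grass F V k, f U = ∑ i ∈ s, h i U) (U : Submodule F V) :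
    kneserAdj k f U = ∑ i ∈ s, kneserAdj k (h i) U := by
  simp only [kneserAdj]
  rw [Finset.sum_comm]
  refine Finset.sum_congr rfl fun W hW => ?_
  split_ifs
  · exact hf W hW
  · simp

theorem isHarmonic_zero_dim (g : Submodule F V → ℝ) : IsHarmonic 0 g :=
  fun _ hR => absurd hR (Nat.not_lt_zero _)

theorem sumBelow_zero_dim [Finite V] (g : Submodule F V → ℝ) (U : Submodule F V) :
    sumBelow 0 g U = g ⊥ := by
  have : grass F V 0 = {⊥} := by
    ext T
    simp [mem_grass, Submodule.finrank_eq_zero]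
  simp [sumBelow, this]

variable [Fintype F] [Finite V]

theorem card_avoiding {k : ℕ} {X T U : Submodule F V} (hTX : T ≤ X) (hUX : U ≤ X)
    (hTU : T ⊓ U = ⊥) (hk : finrank F T ≤ k) :
    (∑ W ∈ grass F V k, if T ≤ W ∧ W ≤ X ∧ W ⊓ U = ⊥ then (1 : ℝ) else 0) =
      avoidCount (Fintype.card F) (finrank F X) k (finrank F U) (finrank F T) := by
  have hq : (1 : ℝ) < Fintype.card F := one_lt_card_real F
  have : Fintype V := Fintype.ofFinite V
  induction h : k - finrank F T generalizing T with
  | zero =>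
    have hk' : finrank F T = k := by omega
    rw [hk', avoidCount_self, Finset.sum_eq_single T]
    · simp [hTX, hTU]
    · intro W hW hne
      rw [if_neg]
      rintro ⟨h1, -⟩
      exact hne (Submodule.eq_of_le_of_finrank_eq h1 (hk'.trans (mem_grass.1 hW).symm)).symm
    · intro hT
      exact absurd (mem_grass.2 hk') hT
  | succ m ih =>
    have hlt : finrank F T < k := by omega
    have hne : (Fintype.card F : ℝ) ^ k - (Fintype.card F : ℝ) ^ finrank F T ≠ 0 :=
      (sub_pos.2 (pow_lt_pow_right₀ hq hlt)).ne'
    refine mul_right_cancel₀ hne ?_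
    rw [avoidCount_succ hq hlt, Finset.sum_mul]
    have hsup : finrank F ↥(T ⊔ U) = finrank F T + finrank F U := by
      have := Submodule.finrank_sup_add_finrank_inf_eq T U
      rwa [hTU, finrank_bot, add_zero] at this
    rw [← hsup, ← sum_indicator_sdiff (sup_le hTX hUX), Finset.sum_mul]
    calc _ = ∑ W ∈ grass F V k, ∑ x : V,
          if (T ≤ W ∧ W ≤ X ∧ W ⊓ U = ⊥) ∧ x ∈ W ∧ x ∉ T then (1 : ℝ) else 0 := by
          refine Finset.sum_congr rfl fun W hW => ?_
          by_cases hc : T ≤ W ∧ W ≤ X ∧ W ⊓ U = ⊥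
          · rw [if_pos hc, one_mul, ← mem_grass.1 hW, ← sum_indicator_sdiff hc.1]
            simp [hc]
          · rw [if_neg hc]
            simp only [hc, false_and, if_false, zero_mul, Finset.sum_const_zero]
      _ = _ := by
          rw [Finset.sum_comm]
          refine Finset.sum_congr rfl fun x _ => ?_
          by_cases hx : x ∈ X ∧ x ∉ T ⊔ U
          · have hxT : x ∉ T := fun h => hx.2 (Submodule.mem_sup_left h)
            have hr := finrank_sup_span_singleton (F := F) hxT
            rw [if_pos hx, one_mul, ← hr, ← ih (T := T ⊔ Submodule.span F {x})
              (sup_le hTX (by simpa using hx.1)) (sup_span_singleton_inf_eq_bot hTU hx.2)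
              (by omega) (by omega)]
            refine Finset.sum_congr rfl fun W _ => if_congr ?_ rfl rfl
            simp only [sup_le_iff, Submodule.span_singleton_le_iff_mem]
            tauto
          · rw [if_neg hx, zero_mul]
            refine Finset.sum_eq_zero fun W _ => if_neg ?_
            rintro ⟨⟨h1, h2, h3⟩, h4, h5⟩
            refine hx ⟨h2 h4, fun h6 => h5 ?_⟩
            obtain ⟨t, ht, u, hu, rfl⟩ := Submodule.mem_sup.1 h6
            have : u ∈ W ⊓ U := ⟨by simpa using W.sub_mem h4 (h1 ht), hu⟩
            rw [h3, Submodule.mem_bot] at this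
            simpa [this] using ht

theorem sum_subspaceMoebius_complements {x : V} (hx : x ≠ 0) {Y : Submodule F V} (hxY : x ∈ Y) :
    (∑ R : Submodule F V, if x ∉ R ∧ R ⊔ Submodule.span F {x} = Y then
      subspaceMoebius (Fintype.card F) (finrank F R) else 0) =
      -subspaceMoebius (Fintype.card F) (finrank F Y) := by
  have hq : (1 : ℝ) < Fintype.card F := one_lt_card_real F
  have hp := finrank_span_singleton (K := F) hx
  have hpY : Submodule.span F {x} ≤ Y := by simpa using hxY
  obtain ⟨i, hi⟩ : ∃ i, finrank F Y = i + 1 :=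
    Nat.exists_eq_add_one.2 (hp.symm.trans_le (Submodule.finrank_mono hpY))
  have hc := card_avoiding (F := F) (k := i) (T := ⊥) (U := Submodule.span F {x}) bot_le hpY
    (bot_inf_eq _) (by simp)
  rw [hi, hp, finrank_bot, avoidCount_hyperplane hq] at hc
  rw [hi, subspaceMoebius_succ, neg_neg, ← hc, Finset.sum_mul, grass, Finset.sum_filter]
  refine Finset.sum_congr rfl fun R _ => ?_
  by_cases hR : x ∉ R ∧ R ⊔ Submodule.span F {x} = Y
  · have hRi : finrank F R = i := by
      have := finrank_sup_span_singleton (F := F) hR.1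
      rw [hR.2] at this
      omega
    have hd : R ⊓ Submodule.span F {x} = ⊥ := by
      rw [← disjoint_iff, Submodule.disjoint_span_singleton' hx]
      exact hR.1
    have hle : R ≤ Y := hR.2 ▸ le_sup_left
    rw [if_pos hR, if_pos hRi, if_pos ⟨bot_le, hle, hd⟩, one_mul, hRi]
  · rw [if_neg hR]
    split_ifs with h1 h2
    · refine absurd ?_ hR
      have hxR : x ∉ R := by
        rw [← Submodule.disjoint_span_singleton' hx, disjoint_iff]
        exact h2.2.2
      refine ⟨hxR, Submodule.eq_of_le_of_finrank_eq (sup_le h2.2.1 hpY) ?_⟩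
      rw [finrank_sup_span_singleton hxR, hi, h1]
    · simp
    · rfl

theorem sum_subspaceMoebius (X : Submodule F V) :
    (∑ R : Submodule F V, if R ≤ X then subspaceMoebius (Fintype.card F) (finrank F R) else 0) =
      if X = ⊥ then 1 else 0 := by
  split_ifs with hX
  · subst hX
    simp [subspaceMoebius]
  obtain ⟨x, hxX, hx⟩ := Submodule.exists_mem_ne_zero_of_ne_bot hX
  calc _ = (∑ R : Submodule F V, if R ≤ X ∧ x ∈ R then
            subspaceMoebius (Fintype.card F) (finrank F R) else 0) +
          ∑ R : Submodule F V, ∑ Y : Submodule F V, if Y ≤ X ∧ x ∈ Y then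
            (if x ∉ R ∧ R ⊔ Submodule.span F {x} = Y then
              subspaceMoebius (Fintype.card F) (finrank F R) else 0) else 0 := by
        rw [← Finset.sum_add_distrib]
        refine Finset.sum_congr rfl fun R _ => ?_
        rw [Finset.sum_eq_single (R ⊔ Submodule.span F {x})]
        · have : x ∈ R ⊔ Submodule.span F {x} :=
            Submodule.mem_sup_right (Submodule.mem_span_singleton_self x)
          by_cases h1 : R ≤ X <;> by_cases h2 : x ∈ R <;> simp [h1, h2, hxX, this]
        · intro Y _ hY
          simp [hY.symm]
        · simp
    _ = 0 := by
        rw [Finset.sum_comm, ← Finset.sum_add_distrib]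
        refine Finset.sum_eq_zero fun Y _ => ?_
        by_cases hY : Y ≤ X ∧ x ∈ Y
        · simp only [if_pos hY]
          rw [sum_subspaceMoebius_complements hx hY.2, add_neg_cancel]
        · simp [hY]

theorem IsHarmonic.sum_disjoint {j : ℕ} {g : Submodule F V → ℝ} (hg : IsHarmonic j g)
    (U : Submodule F V) :
    (∑ T ∈ grass F V j, if T ⊓ U = ⊥ then g T else 0) =
      subspaceMoebius (Fintype.card F) j * sumBelow j g U := by
  calc _ = ∑ T ∈ grass F V j, ∑ R : Submodule F V, if R ≤ U then
          subspaceMoebius (Fintype.card F) (finrank F R) * (if R ≤ T then g T else 0) else 0 := by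
        refine Finset.sum_congr rfl fun T _ => ?_
        have := congrArg (· * g T) (sum_subspaceMoebius (T ⊓ U))
        simp only [ite_mul, one_mul, zero_mul, Finset.sum_mul] at this
        rw [← this]
        refine Finset.sum_congr rfl fun R _ => ?_
        by_cases h1 : R ≤ U <;> by_cases h2 : R ≤ T <;> simp [h1, h2]
    _ = ∑ R : Submodule F V, if finrank F R = j then (if R ≤ U then
          subspaceMoebius (Fintype.card F) j * g R else 0) else 0 := by
        rw [Finset.sum_comm]
        refine Finset.sum_congr rfl fun R _ => ?_
        by_cases hRU : R ≤ U
        · simp only [if_pos hRU, ← Finset.mul_sum]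
          rcases lt_trichotomy (finrank F R) j with h | h | h
          · rw [hg R h, if_neg h.ne, mul_zero]
          · rw [if_pos h, h, Finset.sum_eq_single R]
            · simp
            · intro T hT hne
              rw [if_neg]
              exact fun hle => hne
                (Submodule.eq_of_le_of_finrank_eq hle (h.trans (mem_grass.1 hT).symm)).symm
            · exact fun hR => absurd (mem_grass.2 h) hR
          · rw [if_neg h.ne', Finset.sum_eq_zero, mul_zero]
            intro T hT
            rw [if_neg]
            intro hle
            have := Submodule.finrank_mono hle
            rw [mem_grass.1 hT] at this
            omega
        · simp [hRU]
    _ = _ := by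
        rw [sumBelow, Finset.mul_sum, grass, Finset.sum_filter]
        simp only [mul_ite, mul_zero]

theorem IsHarmonic.kneserAdj_sumBelow {j k : ℕ} (hjk : j ≤ k) {g : Submodule F V → ℝ}
    (hg : IsHarmonic j g) {U : Submodule F V} (hU : U ∈ grass F V k) :
    kneserAdj k (sumBelow j g) U =
      kneserEigenvalue (Fintype.card F) (finrank F V) k j * sumBelow j g U := by
  rw [kneserEigenvalue, mul_assoc, ← hg.sum_disjoint, Finset.mul_sum]
  calc _ = ∑ W ∈ grass F V k, ∑ T ∈ grass F V j,
          (if T ≤ W ∧ W ≤ ⊤ ∧ W ⊓ U = ⊥ then (1 : ℝ) else 0) * g T := by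
        refine Finset.sum_congr rfl fun W _ => ?_
        by_cases h : W ⊓ U = ⊥ <;> simp [h, sumBelow]
    _ = _ := by
        rw [Finset.sum_comm]
        refine Finset.sum_congr rfl fun T hT => ?_
        rw [← Finset.sum_mul]
        split_ifs with h
        · have := card_avoiding (F := F) (k := k) (T := T) (U := U) le_top le_top h
            (by rw [mem_grass.1 hT]; exact hjk)
          rw [this, mem_grass.1 hT, mem_grass.1 hU, finrank_top]
        · rw [Finset.sum_eq_zero, zero_mul, mul_zero]
          intro W _
          rw [if_neg]
          rintro ⟨h1, -, h2⟩
          exact h (eq_bot_iff.2 (h2 ▸ inf_le_inf_right U h1))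

theorem sumBelow_indicator_ge {j k : ℕ} {R U : Submodule F V} (hR : finrank F R ≤ j)
    (hU : U ∈ grass F V k) :
    sumBelow j (fun T => if R ≤ T then 1 else 0) U =
      avoidCount (Fintype.card F) k j 0 (finrank F R) * if R ≤ U then 1 else 0 := by
  split_ifs with h
  · have := card_avoiding (F := F) (k := j) (T := R) (U := ⊥) h bot_le (inf_bot_eq _) hR
    rw [mem_grass.1 hU, finrank_bot] at this
    rw [mul_one, ← this]
    refine Finset.sum_congr rfl fun T _ => ?_
    by_cases h1 : R ≤ T <;> by_cases h2 : T ≤ U <;> simp [h1, h2]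
  · rw [mul_zero]
    refine Finset.sum_eq_zero fun T _ => ?_
    by_cases h1 : R ≤ T <;> by_cases h2 : T ≤ U <;> simp [h1, h2]
    exact h (h1.trans h2)

theorem sumBelow_mem_harmonicSums {k : ℕ} (j : ℕ) (hjk : j ≤ k) (g : Submodule F V → ℝ) :
    sumBelow j g ∈ harmonicSums F V k := by
  induction j using Nat.strong_induction_on generalizing g with
  | _ j ih =>
    obtain ⟨m, hm, horth⟩ := exists_orthogonal_decomposition (grass F V j)
      (Submodule.span ℝ {f | ∃ R : Submodule F V, finrank F R < j ∧
        f = fun T => if R ≤ T then 1 else 0}) g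
    have hsplit : sumBelow j g = sumBelow j m + sumBelow j (g - m) := by
      rw [← sumBelow_add, add_sub_cancel]
    rw [hsplit]
    refine add_mem ?_ (IsHarmonic.sumBelow_mem hjk fun R hR => ?_)
    · clear horth hsplit
      induction hm using Submodule.span_induction with
      | mem f hf =>
        obtain ⟨R, hR, rfl⟩ := hf
        have hmem := (harmonicSums F V k).smul_mem
          (avoidCount (Fintype.card F) k j 0 (finrank F R))
          (ih (finrank F R) hR (by omega) (fun T => if T = R then 1 else 0))
        refine harmonicSums_congr hmem fun U hU => ?_
        rw [sumBelow_indicator_ge hR.le hU, Pi.smul_apply, smul_eq_mul, sumBelow,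
          Finset.sum_eq_single R]
        · simp
        · intro T _ hT
          simp [hT]
        · intro h
          exact absurd (mem_grass.2 rfl) h
      | zero => rw [sumBelow_zero]; exact zero_mem _
      | add f f' _ _ hf hf' => rw [sumBelow_add]; exact add_mem hf hf'
      | smul c f _ hf => rw [sumBelow_smul]; exact Submodule.smul_mem _ c hf
    · have := horth _ (Submodule.subset_span ⟨R, hR, rfl⟩)
      simpa using this

theorem mem_harmonicSums (k : ℕ) (f : Submodule F V → ℝ) : f ∈ harmonicSums F V k := by
  refine harmonicSums_congr (sumBelow_mem_harmonicSums k le_rfl f) fun U hU => ?_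
  rw [sumBelow, Finset.sum_eq_single U]
  · simp
  · intro T hT hne
    rw [if_neg]
    exact fun hle => hne (Submodule.eq_of_le_of_finrank_eq hle
      ((mem_grass.1 hT).trans (mem_grass.1 hU).symm))
  · exact fun h => absurd hU h

theorem IsHarmonic.sum_mul_eq_zero {k i j : ℕ} (hn : 2 * k < finrank F V) (hi : i ≤ k)
    (hj : j ≤ k) (hij : i ≠ j) {g h : Submodule F V → ℝ} (hg : IsHarmonic i g)
    (hh : IsHarmonic j h) : ∑ U ∈ grass F V k, sumBelow i g U * sumBelow j h U = 0 := by
  have hne : kneserEigenvalue (Fintype.card F) (finrank F V) k i ≠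
      kneserEigenvalue (Fintype.card F) (finrank F V) k j := fun h => by
    rcases hij.lt_or_gt with h' | h'
    · exact (abs_kneserEigenvalue_lt (two_le_card_real F) hn h' hj).ne' (congrArg abs h)
    · exact (abs_kneserEigenvalue_lt (two_le_card_real F) hn h' hi).ne (congrArg abs h)
  have hsymm := sum_mul_kneserAdj k (sumBelow i g) (sumBelow j h)
  have hl := Finset.sum_congr (s₁ := grass F V k) rfl fun U hU =>
    congrArg (sumBelow i g U * ·) (hh.kneserAdj_sumBelow hj hU)
  have hr := Finset.sum_congr (s₁ := grass F V k) rfl fun U hU =>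
    congrArg (· * sumBelow j h U) (hg.kneserAdj_sumBelow hi hU)
  simp only [mul_left_comm (sumBelow i g _), mul_assoc, ← Finset.mul_sum] at hl hr
  rw [hl, hr] at hsymm
  by_contra h0
  exact hne (mul_right_cancel₀ h0 hsymm).symm

theorem card_containing {k : ℕ} {T : Submodule F V} (hk : finrank F T ≤ k) :
    (∑ W ∈ grass F V k, if T ≤ W then (1 : ℝ) else 0) =
      avoidCount (Fintype.card F) (finrank F V) k 0 (finrank F T) := by
  have := card_avoiding (F := F) (k := k) (T := T) (U := ⊥) le_top le_top (inf_bot_eq _) hk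
  simpa using this

/-- The case of equality in the ratio bound for the q-Kneser graph: the indicator function of a
maximum independent set is a sum of indicator functions of points. -/
theorem exists_eq_sumBelow_one {k : ℕ} (hk : 1 ≤ k) (hn : 2 * k < finrank F V)
    {x : Submodule F V → ℝ} (hx : ∀ U, x U * x U = x U)
    (hind : ∑ U ∈ grass F V k, x U * kneserAdj k x U = 0)
    (hcard : ∑ U ∈ grass F V k, x U = avoidCount (Fintype.card F) (finrank F V) k 0 1) :
    ∃ g : Submodule F V → ℝ, ∀ U ∈ grass F V k, x U = sumBelow 1 g U := by
  obtain ⟨g, hg, hxg⟩ := mem_harmonicSums k x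
  have hq := one_lt_card_real F
  set q : ℝ := (Fintype.card F : ℝ) with hqdef
  set n := finrank F V with hndef
  set s := avoidCount q n k 0 1 with hs
  set τ := kneserEigenvalue q n k with hτ
  set a : ℕ → ℝ := fun j => ∑ U ∈ grass F V k, sumBelow j (g j) U * sumBelow j (g j) U with ha
  have hinner {j : ℕ} (hj : j ∈ Finset.range (k + 1)) {h : Submodule F V → ℝ}
      (hh : IsHarmonic j h) : ∑ U ∈ grass F V k, x U * sumBelow j h U =
        ∑ U ∈ grass F V k, sumBelow j (g j) U * sumBelow j h U := by
    rw [Finset.sum_congr rfl fun U hU => by rw [hxg U hU, Finset.sum_mul], Finset.sum_comm,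
      Finset.sum_eq_single_of_mem j hj]
    intro i hi hij
    rw [Finset.mem_range] at hi hj
    exact (hg i).sum_mul_eq_zero hn (by omega) (by omega) hij hh
  have hcomb (t : ℕ → ℝ) : ∑ U ∈ grass F V k, x U *
      ∑ j ∈ Finset.range (k + 1), t j * sumBelow j (g j) U =
        ∑ j ∈ Finset.range (k + 1), t j * a j := by
    simp only [Finset.mul_sum, mul_left_comm (x _)]
    rw [Finset.sum_comm]
    refine Finset.sum_congr rfl fun j hj => ?_
    rw [← Finset.mul_sum, hinner hj (hg j), ha, Finset.mul_sum]
  have hsum : ∑ j ∈ Finset.range (k + 1), a j = s := by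
    have := hcomb fun _ => 1
    simp only [one_mul] at this
    rw [← this, ← hcard]
    exact Finset.sum_congr rfl fun U hU => by rw [← hxg U hU, hx]
  have hτsum : ∑ j ∈ Finset.range (k + 1), τ j * a j = 0 := by
    rw [← hcomb, ← hind]
    refine Finset.sum_congr rfl fun U hU => ?_
    rw [kneserAdj_sum k _ hxg]
    congr 1
    refine Finset.sum_congr rfl fun j hj => ?_
    rw [(hg j).kneserAdj_sumBelow (by rw [Finset.mem_range] at hj; omega) hU]
  set c := g 0 ⊥ with hc
  set N := avoidCount q n k 0 0 with hN
  have hNcard : ∑ U ∈ grass F V k, (1 : ℝ) = N := by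
    have := card_containing (F := F) (V := V) (k := k) (T := ⊥) (by simp)
    simpa using this
  have hscN : s = N * c := by
    have := hinner (Finset.mem_range.2 (Nat.succ_pos k)) (isHarmonic_zero_dim fun _ => 1)
    simp only [sumBelow_zero_dim, mul_one] at this
    rw [← hcard, this, ← hNcard, Finset.sum_mul]
    simp [hc]
  have ha0 : a 0 = N * (c * c) := by
    rw [← hNcard, Finset.sum_mul]
    simp [ha, sumBelow_zero_dim, hc]
  have hNs : N * (q ^ k - 1) = (q ^ n - 1) * s := by
    simpa using avoidCount_succ hq (n := n) (d := 0) (j := 0) hk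
  have hτ01 : τ 0 * (q ^ k - 1) = (q ^ n - q ^ k) * -τ 1 := by
    have := avoidCount_succ hq (n := n) (d := k) (j := 0) hk
    simpa [hτ, kneserEigenvalue, subspaceMoebius] using this
  have hτ1 : 0 < -τ 1 := by
    have := avoidCount_pos hq (n := n) (k := k) (d := k) (j := 1) (by omega)
    simpa [hτ, kneserEigenvalue, subspaceMoebius] using this
  have hs0 : 0 < s := avoidCount_pos hq (by omega)
  have hqk : 0 < q ^ k - 1 := sub_pos.2 (one_lt_pow₀ hq (by omega))
  have hfirst : (τ 0 - τ 1) * a 0 = -τ 1 * s := by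
    have hcq : c * (q ^ n - 1) = q ^ k - 1 := by
      refine mul_right_cancel₀ hs0.ne' ?_
      linear_combination (-c) * hNs - (q ^ k - 1) * hscN
    refine mul_right_cancel₀ hqk.ne' ?_
    rw [ha0]
    linear_combination N * c * c * hτ01 - τ 1 * N * c * hcq + τ 1 * (q ^ k - 1) * hscN
  have hlt {j : ℕ} (h2 : 2 ≤ j) (hj : j ≤ k) : 0 < τ j - τ 1 := by
    have := abs_kneserEigenvalue_lt (two_le_card_real F) hn (i := 1) h2 hj
    rw [← hqdef, ← hτ, abs_of_neg (by linarith : τ 1 < 0)] at this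
    linarith [neg_abs_le (τ j)]
  have ha_nonneg (j : ℕ) : 0 ≤ a j := Finset.sum_nonneg fun U _ => mul_self_nonneg _
  have htail : ∑ j ∈ Finset.range k, (τ (j + 1) - τ 1) * a (j + 1) = 0 := by
    have : ∑ j ∈ Finset.range (k + 1), (τ j - τ 1) * a j = -τ 1 * s := by
      simp only [sub_mul, Finset.sum_sub_distrib, hτsum, ← Finset.mul_sum, hsum]
      ring
    rw [Finset.sum_range_succ'] at this
    linarith
  have hzero {j : ℕ} (h2 : 2 ≤ j) (hj : j ≤ k) {U : Submodule F V} (hU : U ∈ grass F V k) :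
      sumBelow j (g j) U = 0 := by
    rw [Finset.sum_eq_zero_iff_of_nonneg] at htail
    · have h0 := htail (j - 1) (Finset.mem_range.2 (by omega))
      rw [Nat.sub_add_cancel (by omega), mul_eq_zero, or_iff_right (hlt h2 hj).ne'] at h0
      exact mul_self_eq_zero.1 ((Finset.sum_eq_zero_iff_of_nonneg
        fun U _ => mul_self_nonneg _).1 h0 U hU)
    · intro i hi
      rw [Finset.mem_range] at hi
      refine mul_nonneg ?_ (ha_nonneg _)
      rcases Nat.eq_zero_or_pos i with rfl | hi0
      · simp
      · exact (hlt (by omega) (by omega)).le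
  have hC : 0 < avoidCount q k 1 0 0 := avoidCount_pos hq (by omega)
  refine ⟨(c / avoidCount q k 1 0 0) • (fun T => if ⊥ ≤ T then 1 else 0) + g 1, fun U hU => ?_⟩
  have hconst := sumBelow_indicator_ge (F := F) (j := 1) (R := ⊥) (by simp) hU
  rw [finrank_bot, ← hqdef] at hconst
  rw [sumBelow_add, sumBelow_smul, Pi.add_apply, Pi.smul_apply, hconst, if_pos bot_le, mul_one,
    smul_eq_mul, div_mul_cancel₀ _ hC.ne', hxg U hU,
    ← Finset.sum_subset (Finset.range_mono (by omega : 2 ≤ k + 1))]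
  · simp [Finset.sum_range_succ, sumBelow_zero_dim, hc]
  · intro j hj hj2
    rw [Finset.mem_range] at hj hj2
    exact hzero (by omega) (by omega) hU

theorem sum_points_eq_zero {k : ℕ} (hk : 1 ≤ k) {X Q : Submodule F V}
    (hX : finrank F X = k + 1) (hQX : Q ≤ X) (hQ : finrank F Q ≤ 1) {g : Submodule F V → ℝ}
    (hg : ∀ H ∈ grass F V k, H ≤ X → sumBelow 1 g H = 0) :
    (∑ p ∈ grass F V 1, if p ≤ X ∧ p ⊓ Q = ⊥ then g p else 0) = 0 := by
  have hC : 0 < avoidCount (Fintype.card F) (finrank F X) k (finrank F Q) 1 :=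
    avoidCount_pos (one_lt_card_real F) (by omega)
  refine (mul_eq_zero_iff_left hC.ne').1 ?_
  calc _ = ∑ p ∈ grass F V 1, ∑ H ∈ grass F V k,
          (if p ≤ H ∧ H ≤ X ∧ H ⊓ Q = ⊥ then (1 : ℝ) else 0) * g p := by
        rw [Finset.mul_sum]
        refine Finset.sum_congr rfl fun p hp => ?_
        rw [← Finset.sum_mul]
        by_cases h : p ≤ X ∧ p ⊓ Q = ⊥
        · rw [if_pos h, card_avoiding h.1 hQX h.2 (by rw [mem_grass.1 hp]; exact hk), mem_grass.1 hp]
        · rw [if_neg h, mul_zero, Finset.sum_eq_zero, zero_mul]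
          intro H _
          rw [if_neg]
          rintro ⟨h1, h2, h3⟩
          exact h ⟨h1.trans h2, eq_bot_iff.2 (h3 ▸ inf_le_inf_right Q h1)⟩
    _ = ∑ H ∈ grass F V k, if H ≤ X ∧ H ⊓ Q = ⊥ then sumBelow 1 g H else 0 := by
        rw [Finset.sum_comm]
        refine Finset.sum_congr rfl fun H _ => ?_
        by_cases h : H ≤ X ∧ H ⊓ Q = ⊥ <;> simp [h, sumBelow]
    _ = 0 := by
        refine Finset.sum_eq_zero fun H hH => ?_
        split_ifs with h
        · exact hg H hH h.1
        · rfl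

theorem eq_zero_of_sumBelow_one_eq_zero {k : ℕ} (hk : 1 ≤ k) {X p : Submodule F V}
    (hX : finrank F X = k + 1) (hp : p ∈ grass F V 1) (hpX : p ≤ X) {g : Submodule F V → ℝ}
    (hg : ∀ H ∈ grass F V k, H ≤ X → sumBelow 1 g H = 0) : g p = 0 := by
  have h1 := sum_points_eq_zero hk hX bot_le (by simp) hg
  have h2 := sum_points_eq_zero hk hX hpX (mem_grass.1 hp).le hg
  rw [← sub_eq_zero.2 (h1.trans h2.symm), ← Finset.sum_sub_distrib,
    Finset.sum_eq_single_of_mem p hp]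
  · have : p ≠ ⊥ := by
      rintro rfl
      simpa using mem_grass.1 hp
    simp [hpX, this]
  · intro r hr hne
    have : r ⊓ p = ⊥ := by
      by_contra hrp
      have hpos : 0 < finrank F ↥(r ⊓ p) :=
        Nat.pos_of_ne_zero fun h => hrp (Submodule.finrank_eq_zero.1 h)
      have h3 : r ⊓ p = r := Submodule.eq_of_le_of_finrank_le inf_le_left
        (by rw [mem_grass.1 hr]; exact hpos)
      have h4 : r ⊓ p = p := Submodule.eq_of_le_of_finrank_le inf_le_right
        (by rw [mem_grass.1 hp]; exact hpos)
      exact hne (h3.symm.trans h4)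
    simp [this]

theorem exists_disjoint_subspace {k : ℕ} (hn : 2 * k < finrank F V) {U p : Submodule F V}
    (hU : finrank F U = k) (hp : finrank F p = 1) (hpU : p ⊓ U = ⊥) :
    ∃ X : Submodule F V, finrank F X = k + 1 ∧ p ≤ X ∧ X ⊓ U = ⊥ := by
  have hc := card_avoiding (F := F) (k := k + 1) le_top le_top hpU (by omega)
  have hpos := avoidCount_pos (one_lt_card_real F) (n := finrank F (⊤ : Submodule F V))
    (k := k + 1) (d := finrank F U) (j := finrank F p) (by rw [finrank_top]; omega)
  rw [← hc] at hpos
  obtain ⟨X, hX, hX'⟩ := Finset.exists_ne_zero_of_sum_ne_zero hpos.ne'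
  rw [ne_eq, ite_eq_right_iff, Classical.not_imp] at hX'
  exact ⟨X, mem_grass.1 hX, hX'.1.1, hX'.1.2.2⟩

/-- A maximum intersecting family of `k`-subspaces is the family of all `k`-subspaces through a
fixed point. -/
theorem eq_star_of_card_eq {k : ℕ} (hk : 1 ≤ k) (hn : 2 * k < finrank F V)
    {S : Finset (Submodule F V)} (hSk : S ⊆ grass F V k)
    (hS : ∀ U ∈ S, ∀ W ∈ S, U ⊓ W ≠ ⊥)
    (hcard : (S.card : ℝ) = avoidCount (Fintype.card F) (finrank F V) k 0 1) :
    ∃ p : Submodule F V, finrank F p = 1 ∧ S = {U ∈ grass F V k | p ≤ U} := by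
  set x : Submodule F V → ℝ := fun U => if U ∈ S then 1 else 0 with hx
  obtain ⟨g, hg⟩ : ∃ g : Submodule F V → ℝ, ∀ U ∈ grass F V k, x U = sumBelow 1 g U := by
    refine exists_eq_sumBelow_one hk hn (fun U => by simp [hx]) ?_ ?_
    · refine Finset.sum_eq_zero fun U _ => ?_
      by_cases hU : U ∈ S
      · rw [kneserAdj, Finset.sum_eq_zero, mul_zero]
        intro W _
        by_cases hW : W ∈ S
        · rw [if_neg (hS W hW U hU)]
        · simp [hx, hW]
      · simp [hx, hU]
    · rw [← hcard, hx, Finset.sum_boole, Finset.filter_mem_eq_inter, Finset.inter_eq_right.2 hSk]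
  have hout {U : Submodule F V} (hU : U ∈ S) {p : Submodule F V} (hp : p ∈ grass F V 1)
      (hpg : g p ≠ 0) : p ≤ U := by
    by_contra hpU
    have hd : p ⊓ U = ⊥ := by
      by_contra hne
      refine hpU (inf_eq_left.1 (Submodule.eq_of_le_of_finrank_le inf_le_left ?_))
      rw [mem_grass.1 hp]
      exact Nat.pos_of_ne_zero fun h => hne (Submodule.finrank_eq_zero.1 h)
    obtain ⟨X, hX, hpX, hXU⟩ :=
      exists_disjoint_subspace hn (mem_grass.1 (hSk hU)) (mem_grass.1 hp) hd
    refine hpg (eq_zero_of_sumBelow_one_eq_zero hk hX hp hpX fun H hH hHX => ?_)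
    rw [← hg H hH, hx]
    refine if_neg fun hHS => hS H hHS U hU (eq_bot_iff.2 (hXU ▸ inf_le_inf_right U hHX))
  have hpos : (0 : ℝ) < S.card := hcard ▸ avoidCount_pos (one_lt_card_real F) (by omega)
  obtain ⟨U, hU⟩ := Finset.card_pos.1 (Nat.cast_pos.1 hpos)
  have hne : sumBelow 1 g U ≠ 0 := by
    rw [← hg U (hSk hU)]
    simp [hx, hU]
  obtain ⟨p, hp, hpg⟩ := Finset.exists_ne_zero_of_sum_ne_zero hne
  rw [ne_eq, ite_eq_right_iff, Classical.not_imp] at hpg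
  refine ⟨p, mem_grass.1 hp, Finset.eq_of_subset_of_card_le
    (fun W hW => Finset.mem_filter.2 ⟨hSk hW, hout hW hp hpg.2⟩) ?_⟩
  have hstar := card_containing (F := F) (k := k) (T := p) (by rw [mem_grass.1 hp]; exact hk)
  rw [Finset.sum_boole, mem_grass.1 hp, ← hcard] at hstar
  exact_mod_cast hstar.le

end Subspaces

theorem avoidCount_mul_prod {q : ℕ} (hq : 1 < q) {v k : ℕ} (hk : 1 ≤ k) (hvk : k ≤ v) :
    avoidCount q v k 0 1 * ((Finset.range (k - 1)).prod fun i => q ^ (i + 1) - 1 : ℕ) =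
      ((Finset.range (k - 1)).prod fun i => q ^ (v - 1 - i) - 1 : ℕ) := by
  have hq0 : (q : ℝ) ≠ 0 := by positivity
  have hq' : (1 : ℝ) < q := by exact_mod_cast hq
  have hcast (i : ℕ) : ((q ^ i - 1 : ℕ) : ℝ) = (q : ℝ) ^ i - 1 := by
    rw [Nat.cast_sub (Nat.one_le_pow _ _ (by omega))]
    simp
  rw [← Finset.prod_range_reflect (fun i => q ^ (i + 1) - 1), avoidCount,
    Finset.prod_Ico_eq_prod_range, Nat.cast_prod, Nat.cast_prod, ← Finset.prod_mul_distrib]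
  refine Finset.prod_congr rfl fun i hi => ?_
  rw [Finset.mem_range] at hi
  have hk' : (q : ℝ) ^ k = q ^ (1 + i) * q ^ (k - 1 - 1 - i + 1) := by
    rw [← pow_add]; congr 1; omega
  have hv' : (q : ℝ) ^ v = q ^ (1 + i) * q ^ (v - 1 - i) := by
    rw [← pow_add]; congr 1; omega
  have hne : (q : ℝ) ^ (k - 1 - 1 - i + 1) - 1 ≠ 0 :=
    (sub_pos.2 (one_lt_pow₀ hq' (by omega))).ne'
  rw [hcast, hcast, add_zero, hk', hv', ← mul_sub_one, ← mul_sub_one]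
  field_simp

theorem gaussBinomial_eq_of_cast_eq_avoidCount {q : ℕ} (hq : 1 < q) {v k : ℕ} (hk : 1 ≤ k)
    (hvk : k ≤ v) {c : ℕ} (hc : (c : ℝ) = avoidCount q v k 0 1) :
    gaussBinomial q (v - 1) (k - 1) = c := by
  have h := avoidCount_mul_prod hq hk hvk
  rw [← hc] at h
  rw [gaussBinomial, ← Nat.cast_injective (R := ℝ) ((Nat.cast_mul _ _).trans h)]
  refine Nat.mul_div_cancel _ (Finset.prod_pos fun i _ => ?_)
  exact Nat.sub_pos_of_lt (Nat.one_lt_pow (by omega) hq)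

end QKneser

open QKneser

/-- Hsieh's theorem: a maximum independent set in the q-Kneser graph `qK_{v:k}`
(for `v > 2k`) is the set of `k`-subspaces through a fixed 1-dimensional
subspace. -/
theorem hsieh
    (q : ℕ) (F : Type*) [Field F] [Fintype F] (hq : Fintype.card F = q)
    (v k : ℕ) (hk : 1 ≤ k) (hvk : 2 * k < v)
    (S : Set (qKneserVert F v k)) (hS : qKneserIndep S)
    (hcard : S.ncard = gaussBinomial q (v - 1) (k - 1)) :
    ∃ ℓ : Submodule F (Fin v → F), Module.finrank F ℓ = 1 ∧
      S = {U : qKneserVert F v k | ℓ ≤ U.1} := by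
  have : Fintype (Submodule F (Fin v → F)) := Fintype.ofFinite _
  have hV : finrank F (Fin v → F) = v := by simp
  -- The number of `k`-subspaces through a point is the Gaussian binomial coefficient.
  have hstar : (gaussBinomial q (v - 1) (k - 1) : ℝ) = avoidCount (Fintype.card F) v k 0 1 := by
    obtain ⟨x, hx⟩ : ∃ x : Fin v → F, x ≠ 0 :=
      ⟨fun _ => 1, fun h => one_ne_zero (congrFun h ⟨0, by omega⟩)⟩
    have hp := finrank_span_singleton (K := F) hx
    have hc := card_containing (k := k) (T := Submodule.span F {x}) (by omega)
    rw [Finset.sum_boole, hp, hV] at hc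
    rw [gaussBinomial_eq_of_cast_eq_avoidCount (hq ▸ Fintype.one_lt_card) hk (by omega)
      (hq ▸ hc), hc]
  have hcard' : ((S.image Subtype.val).toFinset.card : ℝ) =
      avoidCount (Fintype.card F) (finrank F (Fin v → F)) k 0 1 := by
    rw [← Set.ncard_eq_toFinset_card', Set.ncard_image_of_injective _ Subtype.val_injective, hcard,
      hstar, hV]
  obtain ⟨p, hp, hSp⟩ := eq_star_of_card_eq hk (by rw [hV]; exact hvk) (fun U hU => by
      obtain ⟨W, -, rfl⟩ := Set.mem_toFinset.1 hU
      exact mem_grass.2 W.2) (fun U hU W hW => by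
      obtain ⟨U, hUS, rfl⟩ := Set.mem_toFinset.1 hU
      obtain ⟨W, hWS, rfl⟩ := Set.mem_toFinset.1 hW
      by_cases h : U = W
      · subst h
        rw [inf_idem]
        intro h0
        have := U.2
        rw [h0, finrank_bot] at this
        omega
      · exact hS U hUS W hWS h) hcard'
  refine ⟨p, hp, Set.ext fun U => ?_⟩
  have := congrArg (U.1 ∈ ·) hSp
  simpa [mem_grass, U.2] using this
end
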